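/- arXiv:2507.08947 — 6 statements merged into one kernel-verified Lean document; each statement's English description precedes it below -/
import Mathlib

section
/- Assume that U is a random element that is a measurable function of S_l for every l ∈ 𝓛_k (common beamforming CSI) and also a measurable function of (H, S). Suppose m is the essential infimum of the family { MSE_k(v|U) : v ∈ 𝒱_k } and s is the essential supremum of the family { SINR_k^coh(v|U) : v ∈ 𝒱_k }. Then 1 + s = m⁻¹ almost surely (as an identity in [0, ∞]). Furthermore, if v★ ∈ 𝒱_k satisfies MSE_k(v★|U) = m almost surely, then SINR_k^coh(v★|U) = s almost surely. -/
open MeasureTheory ProbabilityTheory Matrix Finset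
open scoped ENNReal ComplexConjugate MeasureTheory

noncomputable section

/-- The canonical uplink massive MIMO model with `K` users and `M = N·L` infrastructure
antennas partitioned into `L` groups of `N` antennas (rows indexed by `Fin L × Fin N`),
with distributed CSI `S l` (the CSI of processing unit `l`) taking values in `𝓢 l`. -/
structure DistUplinkModel (Ω : Type*) [MeasureSpace Ω] (K N L : ℕ)
    (𝓢 : Fin L → Type*) [∀ l, MeasurableSpace (𝓢 l)] where
  x : Fin K → Ω → ℂ
  z : Ω → Fin L × Fin N → ℂ
  H : Ω → Fin L × Fin N → Fin K → ℂ
  S : ∀ l, Ω → 𝓢 l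
  p : Ω → Fin K → ℝ
  hx_meas : ∀ j, Measurable (x j)
  hz_meas : Measurable z
  hH_meas : Measurable H
  hS_meas : ∀ l, Measurable (S l)
  hx_L2 : ∀ j, MemLp (x j) 2 ℙ
  hz_L2 : ∀ i, MemLp (fun ω => z ω i) 2 ℙ
  hx_mean : ∀ j, ∫ ω, x j ω = 0
  hx_var : ∀ j, ∫ ω, ‖x j ω‖ ^ 2 = 1
  hz_mean : ∀ i, ∫ ω, z ω i = 0
  hz_cov : ∀ i i', ∫ ω, z ω i * conj (z ω i') = if i = i' then 1 else 0
  hp_nonneg : ∀ ω j, 0 ≤ p ω j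
  hp_meas : Measurable[MeasurableSpace.comap (fun ω l => S l ω) inferInstance] p
  hp_bdd : ∃ C : ℝ, ∀ᵐ ω, ∀ j, p ω j ≤ C
  /-- `(x 0, …, x (K-1))`, `z` and the pair `(H, S)` are mutually independent. -/
  hindep : iIndep (fun i : Fin K ⊕ Bool =>
    Sum.elim (fun j => MeasurableSpace.comap (x j) inferInstance)
      (fun b => if b then
          MeasurableSpace.comap (fun ω => (H ω, fun l => S l ω)) inferInstance
        else MeasurableSpace.comap z inferInstance) i) ℙ
  /-- `E[‖H Hᴴ‖_F²] < ∞`. -/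
  hHHherm_L2 : Integrable (fun ω =>
    ∑ i, ∑ i', ‖(Matrix.of (H ω) * (Matrix.of (H ω))ᴴ) i i'‖ ^ 2)

namespace DistUplinkModel

variable {Ω : Type*} [MeasureSpace Ω] {K N L : ℕ} {𝓢 : Fin L → Type*}
  [∀ l, MeasurableSpace (𝓢 l)]

/-- The σ-algebra `σ(S_l)` generated by the CSI of processing unit `l`. -/
def mS (Mo : DistUplinkModel Ω K N L 𝓢) (l : Fin L) : MeasurableSpace Ω :=
  MeasurableSpace.comap (Mo.S l) inferInstance

/-- The received uplink signal `r = ∑ j √(p j) • h j * x j + z`. -/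
def r (Mo : DistUplinkModel Ω K N L 𝓢) (ω : Ω) : Fin L × Fin N → ℂ := fun i =>
  (∑ j, (Real.sqrt (Mo.p ω j) : ℂ) * Mo.H ω i j * Mo.x j ω) + Mo.z ω i

/-- `g j v = √(p j) h jᴴ v`. -/
def g (Mo : DistUplinkModel Ω K N L 𝓢) (j : Fin K) (v : Ω → Fin L × Fin N → ℂ) (ω : Ω) : ℂ :=
  (Real.sqrt (Mo.p ω j) : ℂ) * ∑ i, conj (Mo.H ω i j) * v ω i

/-- `MSE k v = E[|x k − vᴴ r|²]`. -/
def MSE (Mo : DistUplinkModel Ω K N L 𝓢) (k : Fin K) (v : Ω → Fin L × Fin N → ℂ) : ℝ :=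
  ∫ ω, ‖Mo.x k ω - ∑ i, conj (v ω i) * Mo.r ω i‖ ^ 2

/-- `MSE_k(v | U) = E[|x k − vᴴ r|² | U]`, as conditional expectation given the σ-algebra `m`. -/
def MSEcond (Mo : DistUplinkModel Ω K N L 𝓢) (m : MeasurableSpace Ω) (k : Fin K)
    (v : Ω → Fin L × Fin N → ℂ) : Ω → ℝ :=
  ℙ[fun ω => ‖Mo.x k ω - ∑ i, conj (v ω i) * Mo.r ω i‖ ^ 2 | m]

/-- The use-and-then-forget SINR (with the convention `0/0 = 0`, which is automatic for real
division in Lean). -/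
def SINR_UatF (Mo : DistUplinkModel Ω K N L 𝓢) (k : Fin K)
    (v : Ω → Fin L × Fin N → ℂ) : ℝ :=
  ‖∫ ω, Mo.g k v ω‖ ^ 2 /
    (((∫ ω, ‖Mo.g k v ω‖ ^ 2) - ‖∫ ω, Mo.g k v ω‖ ^ 2)
      + (∑ j ∈ Finset.univ.erase k, ∫ ω, ‖Mo.g j v ω‖ ^ 2)
      + ∫ ω, ∑ i, ‖v ω i‖ ^ 2)

/-- The coherent-decoding conditional SINR given the σ-algebra `m` (generated by the decoder
side information), with the convention `0/0 = 0`. -/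
def SINR_coh (Mo : DistUplinkModel Ω K N L 𝓢) (m : MeasurableSpace Ω) (k : Fin K)
    (v : Ω → Fin L × Fin N → ℂ) (ω : Ω) : ℝ :=
  ‖(ℙ[Mo.g k v | m]) ω‖ ^ 2 /
    (((ℙ[fun ω' => ‖Mo.g k v ω'‖ ^ 2 | m]) ω - ‖(ℙ[Mo.g k v | m]) ω‖ ^ 2)
      + (∑ j ∈ Finset.univ.erase k, (ℙ[fun ω' => ‖Mo.g j v ω'‖ ^ 2 | m]) ω)
      + (ℙ[fun ω' => ∑ i, ‖v ω' i‖ ^ 2 | m]) ω)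

/-- The information-constrained beamforming set `𝒱_k`: for `l` in the serving cluster `Lk`,
the block `v_l` is `σ(S_l)`-measurable with `E[‖v_l‖⁴] < ∞`, and `v_l = 0` a.s. otherwise. -/
def Vset (Mo : DistUplinkModel Ω K N L 𝓢) (Lk : Finset (Fin L)) :
    Set (Ω → Fin L × Fin N → ℂ) :=
  { v | (∀ l ∈ Lk,
          Measurable[Mo.mS l] (fun ω (n : Fin N) => v ω (l, n)) ∧
          Integrable (fun ω => (∑ n, ‖v ω (l, n)‖ ^ 2) ^ 2)) ∧
        ∀ l ∉ Lk, ∀ᵐ ω, ∀ n, v ω (l, n) = 0 }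

end DistUplinkModel

/-- `b` is an essential infimum of the family `fam` of real random variables:
it is an a.s. lower bound of every member, and dominates any other such a.s. lower bound. -/
def IsEssInfFam {Ω : Type*} [MeasureSpace Ω] (fam : Set (Ω → ℝ)) (b : Ω → ℝ) : Prop :=
  (∀ f ∈ fam, ∀ᵐ ω, b ω ≤ f ω) ∧
    ∀ b' : Ω → ℝ, (∀ f ∈ fam, ∀ᵐ ω, b' ω ≤ f ω) → ∀ᵐ ω, b' ω ≤ b ω

/-- `b` is an essential supremum of the family `fam` of real random variables. -/
def IsEssSupFam {Ω : Type*} [MeasureSpace Ω] (fam : Set (Ω → ℝ)) (b : Ω → ℝ) : Prop :=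
  (∀ f ∈ fam, ∀ᵐ ω, f ω ≤ b ω) ∧
    ∀ b' : Ω → ℝ, (∀ f ∈ fam, ∀ᵐ ω, f ω ≤ b' ω) → ∀ᵐ ω, b ω ≤ b' ω


theorem aux_aesm_sum {Ω ι : Type*} {G m0 : MeasurableSpace Ω} {μ : Measure Ω}
    (t : Finset ι) (f : ι → Ω → ℂ) (hf : ∀ i, AEStronglyMeasurable[G] (f i) μ) :
    AEStronglyMeasurable[G] (fun ω => ∑ i ∈ t, f i ω) μ := by
  classical
  induction t using Finset.induction_on with
  | empty => simpa using stronglyMeasurable_const.aestronglyMeasurable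
  | insert a t ha ih =>
    simp only [Finset.sum_insert ha]
    exact (hf a).add ih

theorem aux_condExp_normSq_sum {Ω ι : Type*} [Fintype ι] [DecidableEq ι] {m0 : MeasurableSpace Ω}
    {μ : Measure Ω} [IsProbabilityMeasure μ] {G W m : MeasurableSpace Ω}
    (hG : G ≤ m0) (hW : W ≤ m0) (hm : m ≤ G) (hind : Indep W G μ) (c w : ι → Ω → ℂ)
    (hcm : ∀ a, AEStronglyMeasurable[G] (c a) μ) (hc : ∀ a, MemLp (c a) 2 μ)
    (hwm : ∀ a, Measurable[W] (w a)) (hw : ∀ a, MemLp (w a) 2 μ)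
    (hcov : ∀ a b, ∫ ω, w a ω * conj (w b ω) ∂μ = if a = b then 1 else 0) :
    μ[fun ω => ‖∑ a, c a ω * w a ω‖ ^ 2 | m] =ᵐ[μ] μ[fun ω => ∑ a, ‖c a ω‖ ^ 2 | m] := by
  have hccm : ∀ a b, AEStronglyMeasurable[G] (fun ω => c a ω * conj (c b ω)) μ := fun a b =>
    (hcm a).mul (Complex.continuous_conj.comp_aestronglyMeasurable (hcm b))
  have hcci : ∀ a b, Integrable (fun ω => c a ω * conj (c b ω)) μ := fun a b =>
    (hc a).integrable_mul (hc b).star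
  have hwwi : ∀ a b, Integrable (fun ω => w a ω * conj (w b ω)) μ := fun a b =>
    (hw a).integrable_mul (hw b).star
  have hwwm : ∀ a b, Measurable[W] (fun ω => w a ω * conj (w b ω)) := fun a b =>
    (hwm a).mul (Complex.continuous_conj.measurable.comp (hwm b))
  have hindf : ∀ a b, IndepFun (fun ω => c a ω * conj (c b ω))
      (fun ω => w a ω * conj (w b ω)) μ := by
    intro a b
    have h1 : IndepFun ((hccm a b).mk _) (fun ω => w a ω * conj (w b ω)) μ := by
      rw [IndepFun_iff_Indep]
      refine indep_of_indep_of_le_left (indep_of_indep_of_le_right hind.symm ?_) ?_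
      · exact (hwwm a b).comap_le
      · exact (hccm a b).stronglyMeasurable_mk.measurable.comap_le
    exact h1.congr (hccm a b).ae_eq_mk.symm Filter.EventuallyEq.rfl
  have hFi : ∀ a b, Integrable (fun ω => (c a ω * conj (c b ω)) * (w a ω * conj (w b ω))) μ :=
    fun a b => (hindf a b).integrable_mul (hcci a b) (hwwi a b)
  have hpt : (fun ω => ‖∑ a, c a ω * w a ω‖ ^ 2) =
      ∑ p : ι × ι, fun ω => ((c p.1 ω * conj (c p.2 ω)) * (w p.1 ω * conj (w p.2 ω))).re := by
    ext ω
    rw [Finset.sum_apply, Fintype.sum_prod_type]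
    have : ((‖∑ a, c a ω * w a ω‖ ^ 2 : ℝ) : ℂ) = ∑ a, ∑ b,
        (c a ω * conj (c b ω)) * (w a ω * conj (w b ω)) := by
      push_cast
      rw [← Complex.mul_conj', map_sum, Finset.sum_mul_sum]
      refine Finset.sum_congr rfl fun a _ => Finset.sum_congr rfl fun b _ => ?_
      rw [map_mul]; ring
    have h2 := congrArg Complex.re this
    simpa only [Complex.ofReal_re, Complex.re_sum] using h2
  have hB : ∀ a b, μ[fun ω => ((c a ω * conj (c b ω)) * (w a ω * conj (w b ω))).re | G]
      =ᵐ[μ] fun ω => if a = b then ‖c a ω‖ ^ 2 else 0 := by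
    intro a b
    have h1 := condExp_bilin_of_aestronglyMeasurable_left
      ((ContinuousLinearMap.compL ℝ ℂ ℂ ℝ Complex.reCLM).comp (ContinuousLinearMap.mul ℝ ℂ))
      (hccm a b) (hFi a b).re (hwwi a b)
    have h2 := condExp_indep_eq (μ := μ) hW hG (hwwm a b).stronglyMeasurable hind
    refine h1.trans ?_
    filter_upwards [h2] with ω h2
    simp only [ContinuousLinearMap.comp_apply, ContinuousLinearMap.compL_apply,
      ContinuousLinearMap.mul_apply', h2, hcov, Complex.reCLM_apply]
    split_ifs with hab
    · subst hab
      rw [mul_one, Complex.mul_conj', ← Complex.ofReal_pow, Complex.ofReal_re]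
    · simp
  have hE : μ[fun ω => ‖∑ a, c a ω * w a ω‖ ^ 2 | G] =ᵐ[μ] fun ω => ∑ a, ‖c a ω‖ ^ 2 := by
    rw [hpt]
    refine (condExp_finsetSum (fun p _ => (hFi p.1 p.2).re) G).trans ?_
    have := ae_all_iff.2 fun p : ι × ι => hB p.1 p.2
    filter_upwards [this] with ω h
    rw [Finset.sum_apply, Finset.sum_congr rfl fun p _ => h p, Fintype.sum_prod_type]
    simp
  exact (condExp_condExp_of_le hm hG).symm.trans (condExp_congr_ae hE)

namespace DistUplinkModel

variable {Ω : Type*} [MeasureSpace Ω] {K N L : ℕ} {𝓢 : Fin L → Type*}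
  [∀ l, MeasurableSpace (𝓢 l)]

/-- The σ-algebra of `(H, S)`. -/
def mG (Mo : DistUplinkModel Ω K N L 𝓢) : MeasurableSpace Ω :=
  MeasurableSpace.comap (fun ω => (Mo.H ω, fun l => Mo.S l ω)) inferInstance

/-- The family of independent sigma-algebras. -/
def mfam (Mo : DistUplinkModel Ω K N L 𝓢) (i : Fin K ⊕ Bool) : MeasurableSpace Ω :=
  Sum.elim (fun j => MeasurableSpace.comap (Mo.x j) inferInstance)
      (fun b => if b then
          MeasurableSpace.comap (fun ω => (Mo.H ω, fun l => Mo.S l ω)) inferInstance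
        else MeasurableSpace.comap Mo.z inferInstance) i

/-- The σ-algebra of `(x, z)`. -/
def mW (Mo : DistUplinkModel Ω K N L 𝓢) : MeasurableSpace Ω :=
  ⨆ i ∈ {i : Fin K ⊕ Bool | i ≠ Sum.inr true}, Mo.mfam i

/-- all inputs -/
def wv (Mo : DistUplinkModel Ω K N L 𝓢) (a : Fin K ⊕ (Fin L × Fin N)) (ω : Ω) : ℂ :=
  Sum.elim (fun j => Mo.x j ω) (fun i => Mo.z ω i) a

theorem mG_le (Mo : DistUplinkModel Ω K N L 𝓢) : Mo.mG ≤ MeasureSpace.toMeasurableSpace := by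
  refine Measurable.comap_le ?_
  exact Mo.hH_meas.prodMk (measurable_pi_lambda _ Mo.hS_meas)

theorem mfam_le (Mo : DistUplinkModel Ω K N L 𝓢) (i) :
    Mo.mfam i ≤ MeasureSpace.toMeasurableSpace := by
  rcases i with j | b
  · exact (Mo.hx_meas j).comap_le
  · cases b
    · exact Mo.hz_meas.comap_le
    · exact Mo.mG_le

theorem mW_le (Mo : DistUplinkModel Ω K N L 𝓢) : Mo.mW ≤ MeasureSpace.toMeasurableSpace :=
  iSup₂_le fun i _ => Mo.mfam_le i

theorem indep_mW_mG (Mo : DistUplinkModel Ω K N L 𝓢) : Indep Mo.mW Mo.mG ℙ := by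
  have h := indep_iSup_of_disjoint (m := Mo.mfam) Mo.mfam_le Mo.hindep
    (S := {i | i ≠ Sum.inr true}) (T := {Sum.inr true}) (by simp)
  simpa [mfam, mG, mW] using h

theorem wv_meas (Mo : DistUplinkModel Ω K N L 𝓢) (a) : Measurable[Mo.mW] (Mo.wv a) := by
  rcases a with j | i
  · have h : Mo.mfam (Sum.inl j) ≤ Mo.mW := le_iSup₂_of_le (Sum.inl j) (by simp) le_rfl
    exact (comap_measurable (Mo.x j)).mono h le_rfl
  · have h : Mo.mfam (Sum.inr false) ≤ Mo.mW := le_iSup₂_of_le (Sum.inr false) (by simp) le_rfl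
    exact (measurable_pi_apply i).comp ((comap_measurable Mo.z).mono h le_rfl)

theorem wv_L2 (Mo : DistUplinkModel Ω K N L 𝓢) (a) : MemLp (Mo.wv a) 2 ℙ := by
  rcases a with j | i
  · exact Mo.hx_L2 j
  · exact Mo.hz_L2 i

theorem cov_zero_of_indep [IsProbabilityMeasure (ℙ : Measure Ω)] {f g : Ω → ℂ}
    (hfg : IndepFun f g ℙ) (hf : AEStronglyMeasurable f ℙ)
    (hg : AEStronglyMeasurable g ℙ) (h0 : ∫ ω, f ω = 0 ∨ ∫ ω, g ω = 0) :
    ∫ ω, f ω * conj (g ω) = 0 := by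
  have h1 : IndepFun f (fun ω => conj (g ω)) ℙ :=
    hfg.comp measurable_id Complex.continuous_conj.measurable
  rw [h1.integral_fun_mul_eq_mul_integral hf (Complex.continuous_conj.comp_aestronglyMeasurable hg)]
  rw [integral_conj]
  rcases h0 with h | h <;> simp [h]

theorem wv_cov [IsProbabilityMeasure (ℙ : Measure Ω)] (Mo : DistUplinkModel Ω K N L 𝓢) (a b) :
    ∫ ω, Mo.wv a ω * conj (Mo.wv b ω) = if a = b then 1 else 0 := by
  have hx := fun j => (Mo.hx_L2 j).1
  have hz := fun i => (Mo.hz_L2 i).1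
  have hxz : ∀ j i, IndepFun (Mo.x j) (fun ω => Mo.z ω i) ℙ := by
    intro j i
    have := Mo.hindep.indep (i := Sum.inl j) (j := Sum.inr false) (by simp)
    have h1 : IndepFun (Mo.x j) Mo.z ℙ := by rw [IndepFun_iff_Indep]; exact this
    exact h1.comp measurable_id (measurable_pi_apply i)
  rcases a with j | i <;> rcases b with j' | i'
  · by_cases h : j = j'
    · subst h
      simp only [wv, Sum.elim_inl, if_true, Complex.mul_conj']
      have := Mo.hx_var j
      rw [← Complex.ofReal_one, ← this, ← integral_complex_ofReal]
      simp
    · have := Mo.hindep.indep (i := Sum.inl j) (j := Sum.inl j') (by simpa using h)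
      have h1 : IndepFun (Mo.x j) (Mo.x j') ℙ := by rw [IndepFun_iff_Indep]; exact this
      rw [if_neg (by simpa using h)]
      exact cov_zero_of_indep h1 (hx j) (hx j') (Or.inl (Mo.hx_mean j))
  · rw [if_neg (by simp)]
    exact cov_zero_of_indep (hxz j i') (hx j) (hz i') (Or.inl (Mo.hx_mean j))
  · rw [if_neg (by simp)]
    exact cov_zero_of_indep (hxz j' i).symm (hz i) (hx j') (Or.inr (Mo.hx_mean j'))
  · simpa [wv] using Mo.hz_cov i i'

theorem sqrtp_meas (Mo : DistUplinkModel Ω K N L 𝓢) (j) :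
    Measurable[Mo.mG] (fun ω => (Real.sqrt (Mo.p ω j) : ℂ)) := by
  have h0 : MeasurableSpace.comap (fun ω l => Mo.S l ω) inferInstance ≤ Mo.mG := by
    refine Measurable.comap_le ?_
    exact measurable_snd.comp (comap_measurable (fun ω => (Mo.H ω, fun l => Mo.S l ω)))
  have h1 : Measurable[Mo.mG] Mo.p := Mo.hp_meas.mono h0 le_rfl
  exact Complex.measurable_ofReal.comp (Real.continuous_sqrt.measurable.comp
    ((measurable_pi_apply j).comp h1))

theorem H_meas (Mo : DistUplinkModel Ω K N L 𝓢) (i j) :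
    Measurable[Mo.mG] (fun ω => Mo.H ω i j) := by
  have h : Measurable[Mo.mG] Mo.H :=
    measurable_fst.comp (comap_measurable (fun ω => (Mo.H ω, fun l => Mo.S l ω)))
  exact (measurable_pi_apply j).comp ((measurable_pi_apply i).comp h)

theorem memLp_four_of {f : Ω → ℂ} (hf : AEStronglyMeasurable f ℙ)
    (h : Integrable (fun ω => ‖f ω‖ ^ 4) ℙ) : MemLp f 4 ℙ := by
  rw [← integrable_norm_rpow_iff hf (by norm_num) (by norm_num)]
  refine h.congr (Filter.Eventually.of_forall fun ω => ?_)
  simp only [ENNReal.toReal_ofNat]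
  norm_cast

theorem H_L4 (Mo : DistUplinkModel Ω K N L 𝓢) (i j) :
    MemLp (fun ω => Mo.H ω i j) 4 ℙ := by
  have hm : Measurable (fun ω => Mo.H ω i j) := (Mo.H_meas i j).mono Mo.mG_le le_rfl
  refine memLp_four_of hm.aestronglyMeasurable ?_
  refine Mo.hHHherm_L2.mono' (hm.norm.pow_const 4).aestronglyMeasurable
    (Filter.Eventually.of_forall fun ω => ?_)
  have h1 : ‖Mo.H ω i j‖ ^ 2 ≤ ‖(Matrix.of (Mo.H ω) * (Matrix.of (Mo.H ω))ᴴ) i i‖ := by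
    have : (Matrix.of (Mo.H ω) * (Matrix.of (Mo.H ω))ᴴ) i i =
        ((∑ j, ‖Mo.H ω i j‖ ^ 2 : ℝ) : ℂ) := by
      simp [Matrix.mul_apply, Complex.mul_conj']
    rw [this, Complex.norm_real, Real.norm_of_nonneg (by positivity)]
    exact Finset.single_le_sum (f := fun j => ‖Mo.H ω i j‖ ^ 2) (fun _ _ => by positivity)
      (Finset.mem_univ j)
  rw [Real.norm_of_nonneg (by positivity)]
  calc ‖Mo.H ω i j‖ ^ 4 = (‖Mo.H ω i j‖ ^ 2) ^ 2 := by ring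
    _ ≤ ‖(Matrix.of (Mo.H ω) * (Matrix.of (Mo.H ω))ᴴ) i i‖ ^ 2 := by gcongr
    _ ≤ ∑ i', ‖(Matrix.of (Mo.H ω) * (Matrix.of (Mo.H ω))ᴴ) i i'‖ ^ 2 :=
      Finset.single_le_sum
        (f := fun i' => ‖(Matrix.of (Mo.H ω) * (Matrix.of (Mo.H ω))ᴴ) i i'‖ ^ 2)
        (fun _ _ => by positivity) (Finset.mem_univ i)
    _ ≤ _ := Finset.single_le_sum
        (f := fun i => ∑ i', ‖(Matrix.of (Mo.H ω) * (Matrix.of (Mo.H ω))ᴴ) i i'‖ ^ 2)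
        (fun _ _ => by positivity) (Finset.mem_univ i)

theorem Vset_meas (Mo : DistUplinkModel Ω K N L 𝓢) {Lk : Finset (Fin L)}
    {v : Ω → Fin L × Fin N → ℂ} (hv : v ∈ Mo.Vset Lk) (i) :
    AEStronglyMeasurable[Mo.mG] (fun ω => v ω i) ℙ := by
  obtain ⟨l, n⟩ := i
  by_cases hl : l ∈ Lk
  · have h0 : Mo.mS l ≤ Mo.mG := by
      refine Measurable.comap_le ?_
      exact (measurable_pi_apply l).comp (measurable_snd.comp
        (comap_measurable (fun ω => (Mo.H ω, fun l => Mo.S l ω))))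
    have h1 : Measurable[Mo.mG] (fun ω (n : Fin N) => v ω (l, n)) :=
      (hv.1 l hl).1.mono h0 le_rfl
    have h2 : Measurable[Mo.mG] (fun ω => v ω (l, n)) := (measurable_pi_apply n).comp h1
    exact h2.stronglyMeasurable.aestronglyMeasurable
  · refine ⟨fun _ => 0, stronglyMeasurable_const, ?_⟩
    filter_upwards [hv.2 l hl] with ω h using h n

theorem Vset_L4 (Mo : DistUplinkModel Ω K N L 𝓢) {Lk : Finset (Fin L)}
    {v : Ω → Fin L × Fin N → ℂ} (hv : v ∈ Mo.Vset Lk) (i) :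
    MemLp (fun ω => v ω i) 4 ℙ := by
  have hm : AEStronglyMeasurable (fun ω => v ω i) ℙ := (Mo.Vset_meas hv i).mono Mo.mG_le
  obtain ⟨l, n⟩ := i
  by_cases hl : l ∈ Lk
  · refine memLp_four_of hm ?_
    refine (hv.1 l hl).2.mono' (hm.norm.pow 4) (Filter.Eventually.of_forall fun ω => ?_)
    rw [Real.norm_of_nonneg (by positivity)]
    calc ‖v ω (l, n)‖ ^ 4 = (‖v ω (l, n)‖ ^ 2) ^ 2 := by ring
      _ ≤ _ := by
        gcongr
        exact Finset.single_le_sum (f := fun n => ‖v ω (l, n)‖ ^ 2) (fun _ _ => by positivity)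
          (Finset.mem_univ n)
  · refine (MemLp.zero (p := 4) (μ := (ℙ : Measure Ω)) (ε := ℂ)).ae_eq ?_
    filter_upwards [hv.2 l hl] with ω h
    simp [h n]

theorem g_meas (Mo : DistUplinkModel Ω K N L 𝓢) {Lk : Finset (Fin L)}
    {v : Ω → Fin L × Fin N → ℂ} (hv : v ∈ Mo.Vset Lk) (j) :
    AEStronglyMeasurable[Mo.mG] (Mo.g j v) ℙ := by
  refine (Mo.sqrtp_meas j).stronglyMeasurable.aestronglyMeasurable.mul ?_
  refine aux_aesm_sum (Finset.univ : Finset (Fin L × Fin N)) _ fun i => ?_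
  exact (Complex.continuous_conj.comp_aestronglyMeasurable
    (Mo.H_meas i j).stronglyMeasurable.aestronglyMeasurable).mul (Mo.Vset_meas hv i)

instance : ENNReal.HolderTriple 4 4 2 := ⟨by
  rw [← two_mul, show (4 : ℝ≥0∞) = 2 * 2 by norm_num,
    ENNReal.mul_inv (by simp) (by simp), ← mul_assoc, ENNReal.mul_inv_cancel (by simp) (by simp),
    one_mul]⟩

theorem g_L2 (Mo : DistUplinkModel Ω K N L 𝓢) {Lk : Finset (Fin L)}
    {v : Ω → Fin L × Fin N → ℂ} (hv : v ∈ Mo.Vset Lk) (j) : MemLp (Mo.g j v) 2 ℙ := by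
  obtain ⟨C, hC⟩ := Mo.hp_bdd
  have h1 : MemLp (fun ω => ∑ i, conj (Mo.H ω i j) * v ω i) 2 ℙ := by
    refine memLp_finsetSum _ fun i _ => ?_
    exact (Mo.Vset_L4 hv i).mul (Mo.H_L4 i j).star
  have hpm : AEStronglyMeasurable (fun ω => (Real.sqrt (Mo.p ω j) : ℂ)) ℙ :=
    ((Mo.sqrtp_meas j).mono Mo.mG_le le_rfl).aestronglyMeasurable
  refine (h1.norm.const_mul (Real.sqrt C)).mono' (hpm.mul h1.1) ?_
  filter_upwards [hC] with ω h
  rw [g, norm_mul, Complex.norm_real, Real.norm_of_nonneg (Real.sqrt_nonneg _)]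
  gcongr
  exact h j

theorem v_L2 [IsProbabilityMeasure (ℙ : Measure Ω)] (Mo : DistUplinkModel Ω K N L 𝓢)
    {Lk : Finset (Fin L)}
    {v : Ω → Fin L × Fin N → ℂ} (hv : v ∈ Mo.Vset Lk) (i) : MemLp (fun ω => v ω i) 2 ℙ :=
  (Mo.Vset_L4 hv i).mono_exponent (by norm_num)

end DistUplinkModel

namespace DistUplinkModel

variable {Ω : Type*} [MeasureSpace Ω] {K N L : ℕ} {𝓢 : Fin L → Type*}
  [∀ l, MeasurableSpace (𝓢 l)]

/-- Total received second moment. -/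
def Tot (Mo : DistUplinkModel Ω K N L 𝓢) (m : MeasurableSpace Ω)
    (v : Ω → Fin L × Fin N → ℂ) (ω : Ω) : ℝ :=
  (∑ j, (ℙ[fun ω' => ‖Mo.g j v ω'‖ ^ 2 | m]) ω) + (ℙ[fun ω' => ∑ i, ‖v ω' i‖ ^ 2 | m]) ω

theorem gsq_int (Mo : DistUplinkModel Ω K N L 𝓢) {Lk : Finset (Fin L)}
    {v : Ω → Fin L × Fin N → ℂ} (hv : v ∈ Mo.Vset Lk) (j) :
    Integrable (fun ω => ‖Mo.g j v ω‖ ^ 2) ℙ := (Mo.g_L2 hv j).integrable_norm_pow (by norm_num)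

variable [IsProbabilityMeasure (ℙ : Measure Ω)]

theorem vsq_int (Mo : DistUplinkModel Ω K N L 𝓢) {Lk : Finset (Fin L)}
    {v : Ω → Fin L × Fin N → ℂ} (hv : v ∈ Mo.Vset Lk) :
    Integrable (fun ω => ∑ i, ‖v ω i‖ ^ 2) ℙ :=
  integrable_finsetSum _ fun i _ => (Mo.v_L2 hv i).integrable_norm_pow (by norm_num)

theorem g_int (Mo : DistUplinkModel Ω K N L 𝓢) {Lk : Finset (Fin L)}
    {v : Ω → Fin L × Fin N → ℂ} (hv : v ∈ Mo.Vset Lk) (j) :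
    Integrable (Mo.g j v) ℙ := (Mo.g_L2 hv j).integrable (by norm_num)

theorem MSE_formula (Mo : DistUplinkModel Ω K N L 𝓢) {Lk : Finset (Fin L)}
    {m : MeasurableSpace Ω} (hm : m ≤ Mo.mG) (k : Fin K)
    {v : Ω → Fin L × Fin N → ℂ} (hv : v ∈ Mo.Vset Lk) :
    Mo.MSEcond m k v =ᵐ[ℙ] fun ω => 1 - 2 * ((ℙ[Mo.g k v | m]) ω).re + Mo.Tot m v ω := by
  have hm0 : m ≤ MeasureSpace.toMeasurableSpace := hm.trans Mo.mG_le
  let c : Fin K ⊕ (Fin L × Fin N) → Ω → ℂ := fun a ω =>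
    Sum.elim (fun j => (if j = k then 1 else 0) - conj (Mo.g j v ω)) (fun i => - conj (v ω i)) a
  have hpt : ∀ ω, Mo.x k ω - ∑ i, conj (v ω i) * Mo.r ω i = ∑ a, c a ω * Mo.wv a ω := by
    intro ω
    simp only [c, wv, Fintype.sum_sum_type, Sum.elim_inl, Sum.elim_inr, r, g, map_mul, map_sum,
      Complex.conj_conj, Complex.conj_ofReal, sub_mul, Finset.sum_sub_distrib, ite_mul, one_mul,
      zero_mul, Finset.sum_ite_eq', Finset.mem_univ, if_true, mul_add, Finset.sum_add_distrib,
      neg_mul, Finset.sum_neg_distrib, Finset.mul_sum, Finset.sum_mul]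
    rw [Finset.sum_comm, sub_add_eq_sub_sub, ← sub_eq_add_neg]
    congr 2
    refine Finset.sum_congr rfl fun j _ => Finset.sum_congr rfl fun i _ => ?_
    ring
  have hcm : ∀ a, AEStronglyMeasurable[Mo.mG] (c a) ℙ := by
    rintro (j | i)
    · exact (stronglyMeasurable_const.aestronglyMeasurable).sub
        (Complex.continuous_conj.comp_aestronglyMeasurable (Mo.g_meas hv j))
    · exact (Complex.continuous_conj.comp_aestronglyMeasurable (Mo.Vset_meas hv i)).neg
  have hcL : ∀ a, MemLp (c a) 2 ℙ := by
    rintro (j | i)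
    · exact (memLp_const _).sub (Mo.g_L2 hv j).star
    · exact (Mo.v_L2 hv i).star.neg
  have h1 := aux_condExp_normSq_sum Mo.mG_le Mo.mW_le hm Mo.indep_mW_mG c Mo.wv hcm hcL
    Mo.wv_meas Mo.wv_L2 Mo.wv_cov
  have h2 : Mo.MSEcond m k v =ᵐ[ℙ] ℙ[fun ω => ∑ a, ‖c a ω‖ ^ 2 | m] := by
    unfold MSEcond
    simp only [hpt]
    exact h1
  let P : Ω → ℝ := fun ω => ((-2 : ℝ) • Complex.reCLM) (Mo.g k v ω)
  have h3 : (fun ω => ∑ a, ‖c a ω‖ ^ 2) =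
      ((fun _ => (1 : ℝ)) + P) +
        ((∑ j, fun ω => ‖Mo.g j v ω‖ ^ 2) + fun ω => ∑ i, ‖v ω i‖ ^ 2) := by
    ext ω
    simp only [c, P, Fintype.sum_sum_type, Sum.elim_inl, Sum.elim_inr, norm_neg, RCLike.norm_conj,
      Pi.add_apply, Finset.sum_apply]
    have : ∀ j, ‖(if j = k then (1 : ℂ) else 0) - conj (Mo.g j v ω)‖ ^ 2 =
        (if j = k then 1 - 2 * (Mo.g k v ω).re else 0) + ‖Mo.g j v ω‖ ^ 2 := by
      intro j
      split_ifs with h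
      · subst h
        simp only [← Complex.normSq_eq_norm_sq, Complex.normSq_apply]
        simp
        ring
      · simp
    rw [Finset.sum_congr rfl fun j _ => this j, Finset.sum_add_distrib]
    simp
    ring
  have hgi := Mo.g_int hv k
  have hPi : Integrable P ℙ := ((-2 : ℝ) • Complex.reCLM).integrable_comp hgi
  have e1 := condExp_add ((integrable_const (μ := ℙ) (1 : ℝ)).add hPi)
    ((integrable_finsetSum' Finset.univ fun j _ => Mo.gsq_int hv j).add (Mo.vsq_int hv)) m
  have e2 := condExp_add (integrable_const (μ := ℙ) (1 : ℝ)) hPi m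
  have e3 := condExp_add (integrable_finsetSum' Finset.univ fun j _ => Mo.gsq_int hv j)
    (Mo.vsq_int hv) m
  have e4 := condExp_finsetSum (fun j (_ : j ∈ Finset.univ) => Mo.gsq_int hv j) m
  have e5 := ((-2 : ℝ) • Complex.reCLM).comp_condExp_comm hgi (m := m)
  rw [h3] at h2
  filter_upwards [h2, e1, e2, e3, e4, e5] with ω h2 e1 e2 e3 e4 e5
  rw [h2, e1, Pi.add_apply, e2, e3, Pi.add_apply, Pi.add_apply, e4, condExp_const hm0, Tot,
    Finset.sum_apply]
  have : (ℙ[P | m]) ω = -2 * ((ℙ[Mo.g k v | m]) ω).re := by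
    rw [← smul_eq_mul]; exact e5.symm
  rw [this]
  ring

theorem facts (Mo : DistUplinkModel Ω K N L 𝓢) {Lk : Finset (Fin L)}
    {m : MeasurableSpace Ω} (hm : m ≤ Mo.mG) (k : Fin K)
    {v : Ω → Fin L × Fin N → ℂ} (hv : v ∈ Mo.Vset Lk) :
    ∀ᵐ ω, ‖(ℙ[Mo.g k v | m]) ω‖ ^ 2 ≤ (ℙ[fun ω' => ‖Mo.g k v ω'‖ ^ 2 | m]) ω ∧
      (∀ j, 0 ≤ (ℙ[fun ω' => ‖Mo.g j v ω'‖ ^ 2 | m]) ω) ∧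
      0 ≤ (ℙ[fun ω' => ∑ i, ‖v ω' i‖ ^ 2 | m]) ω ∧
      ((ℙ[fun ω' => ∑ i, ‖v ω' i‖ ^ 2 | m]) ω = 0 → (ℙ[Mo.g k v | m]) ω = 0) := by
  have hm0 : m ≤ MeasureSpace.toMeasurableSpace := hm.trans Mo.mG_le
  have f1 : ∀ᵐ ω, ‖(ℙ[Mo.g k v | m]) ω‖ ^ 2 ≤ (ℙ[fun ω' => ‖Mo.g k v ω'‖ ^ 2 | m]) ω := by
    have h := Integrable.norm_condExp_rpow_le (μ := @MeasureSpace.volume Ω _) (m := m) (f := Mo.g k v)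
      (p := 2) (by norm_num) (by simpa using Mo.gsq_int hv k)
    simp only [Real.rpow_ofNat] at h
    exact h
  have f2 : ∀ᵐ ω, ∀ j, 0 ≤ (ℙ[fun ω' => ‖Mo.g j v ω'‖ ^ 2 | m]) ω :=
    ae_all_iff.2 fun j => condExp_nonneg (Filter.Eventually.of_forall fun ω => by
      simp only [Pi.zero_apply]; positivity)
  have f3 : ∀ᵐ ω, 0 ≤ (ℙ[fun ω' => ∑ i, ‖v ω' i‖ ^ 2 | m]) ω :=
    condExp_nonneg (Filter.Eventually.of_forall fun ω => by
      simp only [Pi.zero_apply]; positivity)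
  let F : Set Ω := {ω | (ℙ[fun ω' => ∑ i, ‖v ω' i‖ ^ 2 | m]) ω = 0}
  have hF : MeasurableSet[m] F :=
    stronglyMeasurable_condExp.measurable (measurableSet_singleton (0 : ℝ))
  have h0 : ∫ ω in F, ∑ i, ‖v ω i‖ ^ 2 = 0 := by
    rw [← setIntegral_condExp hm0 (Mo.vsq_int hv) hF]
    exact setIntegral_eq_zero_of_forall_eq_zero fun ω h => h
  have h1 : (fun ω => ∑ i, ‖v ω i‖ ^ 2) =ᵐ[(@MeasureSpace.volume Ω _).restrict F] 0 :=
    (integral_eq_zero_iff_of_nonneg (fun ω => by simp only [Pi.zero_apply]; positivity)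
      (Mo.vsq_int hv).integrableOn).1 h0
  have h2 : Mo.g k v =ᵐ[(@MeasureSpace.volume Ω _).restrict F] 0 := by
    filter_upwards [h1] with ω h
    have h' : ∀ i, v ω i = 0 := by
      intro i
      have := (Finset.sum_eq_zero_iff_of_nonneg (fun i _ => by positivity)).1 h i
        (Finset.mem_univ i)
      simpa using this
    simp [g, h']
  have h3 := condExp_ae_eq_restrict_zero (μ := ℙ) hF h2
  have f4 := (ae_restrict_iff' (hm0 _ hF)).1 h3
  filter_upwards [f1, f2, f3, f4] with ω f1 f2 f3 f4
  exact ⟨f1, f2, f3, fun h => f4 h⟩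

/-- Scaling a beamformer. -/
theorem scaled (Mo : DistUplinkModel Ω K N L 𝓢) {Lk : Finset (Fin L)}
    {m : MeasurableSpace Ω} (hm : m ≤ Mo.mG) (hmS : ∀ l ∈ Lk, m ≤ Mo.mS l) (k : Fin K)
    {v : Ω → Fin L × Fin N → ℂ} (hv : v ∈ Mo.Vset Lk) (c : Ω → ℂ) (hc : StronglyMeasurable[m] c)
    (B : ℝ) (hB : ∀ ω, ‖c ω‖ ≤ B) :
    (fun ω i => c ω * v ω i) ∈ Mo.Vset Lk ∧
    ∀ᵐ ω, (Mo.MSEcond m k (fun ω i => c ω * v ω i)) ω =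
      1 - 2 * (c ω * (ℙ[Mo.g k v | m]) ω).re + ‖c ω‖ ^ 2 * Mo.Tot m v ω := by
  have hm0 : m ≤ MeasureSpace.toMeasurableSpace := hm.trans Mo.mG_le
  have hmem : (fun ω i => c ω * v ω i) ∈ Mo.Vset Lk := by
    refine ⟨fun l hl => ⟨?_, ?_⟩, fun l hl => ?_⟩
    · have hcl : Measurable[Mo.mS l] c := hc.measurable.mono (hmS l hl) le_rfl
      have hvl := (hv.1 l hl).1
      exact @measurable_pi_lambda _ _ _ (Mo.mS l) _ _ fun n =>
        hcl.mul ((measurable_pi_apply n).comp hvl)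
    · have hi := (hv.1 l hl).2
      have : (fun ω => (∑ n, ‖c ω * v ω (l, n)‖ ^ 2) ^ 2) =
          fun ω => ‖c ω‖ ^ 4 * (∑ n, ‖v ω (l, n)‖ ^ 2) ^ 2 := by
        ext ω
        simp only [norm_mul, mul_pow, ← Finset.mul_sum]
        ring
      rw [this]
      refine hi.bdd_mul (c := B ^ 4) ((hc.mono hm0).norm.pow 4).aestronglyMeasurable ?_
      refine Filter.Eventually.of_forall fun ω => ?_
      rw [Real.norm_of_nonneg (by positivity)]
      gcongr
      exact hB ω
    · filter_upwards [hv.2 l hl] with ω h n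
      simp [h n]
  refine ⟨hmem, ?_⟩
  have hg : ∀ j ω, Mo.g j (fun ω i => c ω * v ω i) ω = c ω * Mo.g j v ω := by
    intro j ω
    simp only [g, Finset.mul_sum]
    exact Finset.sum_congr rfl fun i _ => by ring
  have hgf : Mo.g k (fun ω i => c ω * v ω i) = fun ω => c ω * Mo.g k v ω := funext (hg k)
  have e1 : ℙ[Mo.g k (fun ω i => c ω * v ω i) | m] =ᵐ[ℙ] fun ω => c ω * (ℙ[Mo.g k v | m]) ω := by
    have h := Mo.g_int hmem k
    rw [hgf] at h ⊢
    exact condExp_bilin_of_stronglyMeasurable_left (ContinuousLinearMap.mul ℝ ℂ) hc h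
      (Mo.g_int hv k)
  have hc2 : StronglyMeasurable[m] (fun ω => ‖c ω‖ ^ 2) := hc.norm.pow 2
  have e2 : ∀ᵐ ω, ∀ j, (ℙ[fun ω' => ‖Mo.g j (fun ω i => c ω * v ω i) ω'‖ ^ 2 | m]) ω =
      ‖c ω‖ ^ 2 * (ℙ[fun ω' => ‖Mo.g j v ω'‖ ^ 2 | m]) ω := by
    refine ae_all_iff.2 fun j => ?_
    have h := Mo.gsq_int hmem j
    simp only [hg, norm_mul, mul_pow] at h ⊢
    exact condExp_mul_of_stronglyMeasurable_left hc2 h (Mo.gsq_int hv j)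
  have e3 : ∀ᵐ ω, (ℙ[fun ω' => ∑ i, ‖c ω' * v ω' i‖ ^ 2 | m]) ω =
      ‖c ω‖ ^ 2 * (ℙ[fun ω' => ∑ i, ‖v ω' i‖ ^ 2 | m]) ω := by
    have h := Mo.vsq_int hmem
    simp only [norm_mul, mul_pow, ← Finset.mul_sum] at h ⊢
    exact condExp_mul_of_stronglyMeasurable_left hc2 h (Mo.vsq_int hv)
  filter_upwards [Mo.MSE_formula hm k hmem, e1, e2, e3] with ω h e1 e2 e3
  rw [h, e1, Tot, Tot, Finset.sum_congr rfl fun j _ => e2 j, e3, ← Finset.mul_sum]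
  ring

theorem SINR_eq (Mo : DistUplinkModel Ω K N L 𝓢) (m : MeasurableSpace Ω) (k : Fin K)
    (v : Ω → Fin L × Fin N → ℂ) (ω : Ω) :
    Mo.SINR_coh m k v ω = ‖(ℙ[Mo.g k v | m]) ω‖ ^ 2 /
      (Mo.Tot m v ω - ‖(ℙ[Mo.g k v | m]) ω‖ ^ 2) := by
  rw [SINR_coh, Tot, ← Finset.add_sum_erase _ _ (Finset.mem_univ k)]
  congr 1
  ring

/-- The basic relation between total power and mean. -/
theorem tot_facts (Mo : DistUplinkModel Ω K N L 𝓢) {Lk : Finset (Fin L)}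
    {m : MeasurableSpace Ω} (hm : m ≤ Mo.mG) (k : Fin K)
    {v : Ω → Fin L × Fin N → ℂ} (hv : v ∈ Mo.Vset Lk) :
    ∀ᵐ ω, 0 ≤ Mo.Tot m v ω ∧ ((ℙ[Mo.g k v | m]) ω = 0 ∨
      ‖(ℙ[Mo.g k v | m]) ω‖ ^ 2 < Mo.Tot m v ω) := by
  filter_upwards [Mo.facts hm k hv] with ω ⟨h1, h2, h3, h4⟩
  have ho : 0 ≤ ∑ j ∈ Finset.univ.erase k, (ℙ[fun ω' => ‖Mo.g j v ω'‖ ^ 2 | m]) ω :=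
    Finset.sum_nonneg fun j _ => h2 j
  rw [Tot, ← Finset.add_sum_erase _ _ (Finset.mem_univ k)]
  refine ⟨by linarith [h2 k], ?_⟩
  rcases h3.eq_or_lt with h | h
  · exact Or.inl (h4 h.symm)
  · right; linarith

theorem lower (Mo : DistUplinkModel Ω K N L 𝓢) {Lk : Finset (Fin L)}
    {m : MeasurableSpace Ω} (hm : m ≤ Mo.mG) (k : Fin K)
    {v : Ω → Fin L × Fin N → ℂ} (hv : v ∈ Mo.Vset Lk) :
    ∀ᵐ ω, 0 ≤ Mo.SINR_coh m k v ω ∧ 1 / (1 + Mo.SINR_coh m k v ω) ≤ Mo.MSEcond m k v ω := by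
  filter_upwards [Mo.MSE_formula hm k hv, Mo.tot_facts hm k hv] with ω h1 ⟨hT, h2⟩
  rw [h1, SINR_eq]
  set A := (ℙ[Mo.g k v | m]) ω
  set T := Mo.Tot m v ω
  rcases h2 with h2 | h2
  · rw [h2]; simp [hT]
  · have hA : A.re ≤ ‖A‖ := Complex.re_le_norm A
    have hT' : 0 < T := lt_of_le_of_lt (by positivity) h2
    have hd : 0 < T - ‖A‖ ^ 2 := by linarith
    refine ⟨by positivity, ?_⟩
    have : 1 / (1 + ‖A‖ ^ 2 / (T - ‖A‖ ^ 2)) = 1 - ‖A‖ ^ 2 / T := by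
      have : 1 + ‖A‖ ^ 2 / (T - ‖A‖ ^ 2) = T / (T - ‖A‖ ^ 2) := by field_simp; ring
      rw [this]; field_simp
    rw [this]
    have h5 : 0 ≤ (T - ‖A‖) ^ 2 / T := by positivity
    have h6 : (T - ‖A‖) ^ 2 / T = T - 2 * ‖A‖ + ‖A‖ ^ 2 / T := by field_simp; ring
    linarith

theorem upper (Mo : DistUplinkModel Ω K N L 𝓢) {Lk : Finset (Fin L)}
    {m : MeasurableSpace Ω} (hm : m ≤ Mo.mG) (hmS : ∀ l ∈ Lk, m ≤ Mo.mS l) (k : Fin K)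
    {v : Ω → Fin L × Fin N → ℂ} (hv : v ∈ Mo.Vset Lk) (b : Ω → ℝ)
    (hb : ∀ u ∈ Mo.Vset Lk, ∀ᵐ ω, b ω ≤ Mo.MSEcond m k u ω) :
    ∀ᵐ ω, b ω ≤ 1 / (1 + Mo.SINR_coh m k v ω) := by
  let c : Ω → ℂ := fun ω => conj ((ℙ[Mo.g k v | m]) ω) * (((Mo.Tot m v ω)⁻¹ : ℝ) : ℂ)
  have hTm : Measurable[m] (Mo.Tot m v) := by
    unfold Tot
    have h1 : ∀ f : Ω → ℝ, Measurable[m] (ℙ[f | m]) :=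
      fun f => stronglyMeasurable_condExp.measurable
    refine Measurable.add ?_ (h1 _)
    exact Finset.measurable_fun_sum _ fun j _ => h1 _
  have hc : Measurable[m] c :=
    (Complex.continuous_conj.measurable.comp stronglyMeasurable_condExp.measurable).mul
      (Complex.measurable_ofReal.comp hTm.inv)
  let cn : ℕ → Ω → ℂ := fun n => {ω | ‖c ω‖ ≤ n}.indicator c
  have hcn : ∀ n, StronglyMeasurable[m] (cn n) := fun n =>
    (hc.indicator (hc.norm measurableSet_Iic)).stronglyMeasurable
  have hcB : ∀ n ω, ‖cn n ω‖ ≤ n := by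
    intro n ω
    by_cases h : ‖c ω‖ ≤ n
    · simpa [cn, Set.indicator, h] using h
    · simp [cn, Set.indicator, h]
  have hs := fun n => Mo.scaled hm hmS k hv (cn n) (hcn n) n (hcB n)
  have h1 := ae_all_iff.2 fun n => (hs n).2
  have h2 := ae_all_iff.2 fun n => hb _ (hs n).1
  filter_upwards [h1, h2, Mo.tot_facts hm k hv] with ω h1 h2 ⟨hT, h3⟩
  obtain ⟨n, hn⟩ := exists_nat_ge ‖c ω‖
  have hcc : cn n ω = c ω := by simp [cn, Set.indicator, hn]
  refine (h2 n).trans (le_of_eq ?_)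
  rw [h1 n, hcc, SINR_eq]
  simp only [c]
  set A := (ℙ[Mo.g k v | m]) ω
  set T := Mo.Tot m v ω
  rcases h3 with h3 | h3
  · rw [h3]; simp
  · have hT' : 0 < T := lt_of_le_of_lt (by positivity) h3
    have hd : 0 < T - ‖A‖ ^ 2 := by linarith
    have e1 : (conj A * ((T⁻¹ : ℝ) : ℂ) * A).re = ‖A‖ ^ 2 * T⁻¹ := by
      have : conj A * ((T⁻¹ : ℝ) : ℂ) * A = ((‖A‖ ^ 2 * T⁻¹ : ℝ) : ℂ) := by
        rw [mul_right_comm, mul_comm (conj A), Complex.mul_conj']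
        push_cast; ring
      rw [this, Complex.ofReal_re]
    have e2 : ‖conj A * ((T⁻¹ : ℝ) : ℂ)‖ = ‖A‖ * T⁻¹ := by
      rw [norm_mul, RCLike.norm_conj, Complex.norm_real, Real.norm_of_nonneg (by positivity)]
    rw [e1, e2]
    have : 1 + ‖A‖ ^ 2 / (T - ‖A‖ ^ 2) = T / (T - ‖A‖ ^ 2) := by field_simp; ring
    rw [this]
    field_simp
    ring

end DistUplinkModel
/-- If the decoder side information `U` is common beamforming CSI
(a measurable function of `S_l` for every `l` in the serving cluster) and a measurable
function of `(H, S)`, and if `m` (resp. `s`) is the essential infimum (resp. supremum) of the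
family of conditional MSEs (resp. conditional SINRs) over `𝒱_k`, then almost surely
`1 + s = m⁻¹` (in `[0, ∞]`); and any `vopt ∈ 𝒱_k` whose conditional MSE equals `m` a.s.
has conditional SINR equal to `s` a.s. -/
theorem one_add_esssup_sinr_eq_inv_essinf_mse
    {Ω : Type*} [MeasureSpace Ω] [IsProbabilityMeasure (ℙ : Measure Ω)]
    {K N L : ℕ} {𝓢 : Fin L → Type*} [∀ l, MeasurableSpace (𝓢 l)]
    {𝓤 : Type*} [MeasurableSpace 𝓤]
    (Mo : DistUplinkModel Ω K N L 𝓢) (Lk : Finset (Fin L)) (k : Fin K)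
    (U : Ω → 𝓤) (hU : Measurable U)
    (hUcommon : ∀ l ∈ Lk,
      MeasurableSpace.comap U inferInstance ≤ Mo.mS l)
    (hUHS : MeasurableSpace.comap U inferInstance ≤
      MeasurableSpace.comap (fun ω => (Mo.H ω, fun l => Mo.S l ω)) inferInstance)
    (m s : Ω → ℝ)
    (hm : IsEssInfFam
      ((fun v => Mo.MSEcond (MeasurableSpace.comap U inferInstance) k v) '' Mo.Vset Lk) m)
    (hs : IsEssSupFam
      ((fun v => Mo.SINR_coh (MeasurableSpace.comap U inferInstance) k v) '' Mo.Vset Lk) s) :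
    (∀ᵐ ω, 1 + ENNReal.ofReal (s ω) = (ENNReal.ofReal (m ω))⁻¹) ∧
    ∀ vopt ∈ Mo.Vset Lk,
      (Mo.MSEcond (MeasurableSpace.comap U inferInstance) k vopt =ᵐ[ℙ] m) →
      (Mo.SINR_coh (MeasurableSpace.comap U inferInstance) k vopt =ᵐ[ℙ] s) := by
  have hmG : MeasurableSpace.comap U inferInstance ≤ Mo.mG := hUHS
  have hb : ∀ u ∈ Mo.Vset Lk, ∀ᵐ ω,
      m ω ≤ Mo.MSEcond (MeasurableSpace.comap U inferInstance) k u ω :=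
    fun u hu => hm.1 _ ⟨u, hu, rfl⟩
  have hsb : ∀ u ∈ Mo.Vset Lk, ∀ᵐ ω,
      Mo.SINR_coh (MeasurableSpace.comap U inferInstance) k u ω ≤ s ω :=
    fun u hu => hs.1 _ ⟨u, hu, rfl⟩
  have hz : (fun _ _ => 0 : Ω → Fin L × Fin N → ℂ) ∈ Mo.Vset Lk := by
    refine ⟨fun l _ => ⟨measurable_const, by simp⟩, fun l _ => by simp⟩
  have hs0 : ∀ᵐ ω, 0 ≤ s ω := by
    filter_upwards [Mo.lower hmG k hz, hsb _ hz] with ω h1 h2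
    exact h1.1.trans h2
  have hlow : ∀ᵐ ω, 1 / (1 + s ω) ≤ m ω := by
    refine hm.2 (fun ω => 1 / (1 + s ω)) ?_
    rintro _ ⟨v, hv, rfl⟩
    filter_upwards [Mo.lower hmG k hv, hsb v hv] with ω h1 h2
    refine le_trans ?_ h1.2
    have := h1.1
    gcongr
  have hup : ∀ᵐ ω, s ω ≤ 1 / m ω - 1 := by
    refine hs.2 (fun ω => 1 / m ω - 1) ?_
    rintro _ ⟨v, hv, rfl⟩
    filter_upwards [Mo.lower hmG k hv, hlow, hs0, Mo.upper hmG hUcommon k hv m hb]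
      with ω h1 h2 h3 h4
    have hm0 : 0 < m ω := lt_of_lt_of_le (by positivity) h2
    have h5 : 0 < 1 + Mo.SINR_coh (MeasurableSpace.comap U inferInstance) k v ω := by
      linarith [h1.1]
    have := (le_one_div hm0 h5).1 h4
    linarith
  refine ⟨?_, fun vopt hvopt heq => ?_⟩
  · filter_upwards [hlow, hup, hs0] with ω h1 h2 h3
    have hm0 : 0 < m ω := lt_of_lt_of_le (by positivity) h1
    have h4 : 1 + s ω = (m ω)⁻¹ := by
      have h5 : 1 / m ω ≤ 1 + s ω := (one_div_le hm0 (by positivity)).2 h1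
      rw [← one_div]
      linarith
    rw [← ENNReal.ofReal_inv_of_pos hm0, ← h4, ENNReal.ofReal_add zero_le_one h3,
      ENNReal.ofReal_one]
  · filter_upwards [heq, Mo.lower hmG k hvopt, hsb _ hvopt, hup, hs0, hlow]
      with ω h1 h2 h3 h4 h5 h6
    refine le_antisymm h3 ?_
    have hm0 : 0 < m ω := lt_of_lt_of_le (by positivity) h6
    rw [h1] at h2
    have h7 := (one_div_le hm0 (by linarith [h2.1])).2 h2.2
    linarith
end
end

section
/- Assume that U is a random element that is a measurable function of S_l for every l ∈ 𝓛_k (common beamforming CSI) and a measurable function of (H, S), and assume p is σ(S_l)-measurable for every l ∈ 𝓛_k. Then v★ ∈ 𝒱_k attains inf_{v ∈ 𝒱_k} MSE_k(v) if and only if v★ attains the essential infimum of the family { MSE_k(v|U) : v ∈ 𝒱_k }, i.e. MSE_k(v★|U) ≤ MSE_k(v|U) a.s. for every v ∈ 𝒱_k. -/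
open MeasureTheory ProbabilityTheory Matrix Finset
open scoped ENNReal ComplexConjugate MeasureTheory

noncomputable section

theorem memLp_two_mul_of_indep {Ω : Type*} [MeasureSpace Ω] {X Y : Ω → ℂ}
    (hX : MemLp X 2 ℙ) (hY : MemLp Y 2 ℙ) (h : IndepFun X Y ℙ) :
    MemLp (fun ω => X ω * Y ω) 2 ℙ := by
  have hm : AEStronglyMeasurable (fun ω => X ω * Y ω) ℙ :=
    hX.aestronglyMeasurable.mul hY.aestronglyMeasurable
  rw [memLp_two_iff_integrable_sq_norm hm]
  have h1 := (memLp_two_iff_integrable_sq_norm hX.aestronglyMeasurable).1 hX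
  have h2 := (memLp_two_iff_integrable_sq_norm hY.aestronglyMeasurable).1 hY
  have hφ : Measurable (fun c : ℂ => ‖c‖ ^ 2) := by fun_prop
  have h3 := (h.comp hφ hφ).integrable_mul h1 h2
  refine h3.congr (ae_of_all _ fun ω => ?_)
  simp [mul_pow]

theorem memLp_four_of_integrable {Ω : Type*} [MeasureSpace Ω] {X : Ω → ℂ} {F : Ω → ℝ}
    (hX : Measurable X) (hF : Integrable F) (h : ∀ ω, ‖X ω‖ ^ 4 ≤ F ω) :
    MemLp X 4 ℙ := by
  have h4 : Integrable (fun ω => ‖X ω‖ ^ 4) := by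
    refine hF.mono' (by fun_prop) (ae_of_all _ fun ω => ?_)
    rw [Real.norm_of_nonneg (by positivity)]
    exact h ω
  have := (integrable_norm_rpow_iff (p := 4) hX.aestronglyMeasurable (by norm_num)
    (by norm_num)).1 (by
      refine h4.congr (ae_of_all _ fun ω => ?_)
      have : ((4 : ℝ≥0∞).toReal) = ((4 : ℕ) : ℝ) := by norm_num
      simp only [this, Real.rpow_natCast])
  exact this

namespace DistUplinkModel

/-- The σ-algebra generated by `(H, S)`. -/
@[reducible]
def mHS {Ω : Type*} [MeasureSpace Ω]
    {K N L : ℕ} {𝓢 : Fin L → Type*} [∀ l, MeasurableSpace (𝓢 l)]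
    (Mo : DistUplinkModel Ω K N L 𝓢) : MeasurableSpace Ω :=
  MeasurableSpace.comap (fun ω => (Mo.H ω, fun l => Mo.S l ω)) inferInstance

/-- The σ-algebra generated by `U`. -/
@[reducible]
def mU {Ω 𝓤 : Type*} [MeasurableSpace 𝓤] (U : Ω → 𝓤) : MeasurableSpace Ω :=
  MeasurableSpace.comap U inferInstance

set_option maxHeartbeats 1000000 in
theorem memLp_err_aux {Ω : Type*} [MeasureSpace Ω] [IsProbabilityMeasure (ℙ : Measure Ω)]
    {K N L : ℕ} {𝓢 : Fin L → Type*} [∀ l, MeasurableSpace (𝓢 l)]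
    (Mo : DistUplinkModel Ω K N L 𝓢) (Lk : Finset (Fin L)) (k : Fin K)
    (v : Ω → Fin L × Fin N → ℂ) (hv : v ∈ Mo.Vset Lk) :
    MemLp (fun ω => Mo.x k ω - ∑ i, conj (v ω i) * Mo.r ω i) 2 ℙ := by
  refine (Mo.hx_L2 k).sub (memLp_finsetSum _ fun i _ => ?_)
  obtain ⟨l, n⟩ := i
  by_cases hl : l ∈ Lk
  swap
  · refine (memLp_congr_ae ?_).2 (MemLp.zero (p := 2) (μ := ℙ) (ε := ℂ))
    filter_upwards [hv.2 l hl] with ω hω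
    simp [hω n]
  obtain ⟨hvm, hvi⟩ := hv.1 l hl
  have hHSmeas : Measurable (fun ω => (Mo.H ω, fun l => Mo.S l ω)) :=
    Mo.hH_meas.prodMk (measurable_pi_lambda _ Mo.hS_meas)
  have hle : Mo.mHS ≤ MeasureSpace.toMeasurableSpace := hHSmeas.comap_le
  have hpair : Measurable[Mo.mHS] (fun ω => (Mo.H ω, fun l => Mo.S l ω)) :=
    comap_measurable _
  have hHm : Measurable[Mo.mHS] Mo.H := measurable_fst.comp hpair
  have hSm : Measurable[Mo.mHS] (fun ω l => Mo.S l ω) := measurable_snd.comp hpair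
  have hSlm : Measurable[Mo.mHS] (Mo.S l) := (measurable_pi_apply l).comp hSm
  have hpm : Measurable[Mo.mHS] Mo.p := Mo.hp_meas.mono hSm.comap_le le_rfl
  have hvm' : Measurable[Mo.mHS] (fun ω => v ω (l, n)) :=
    (measurable_pi_apply n).comp (hvm.mono hSlm.comap_le le_rfl)
  have hcv : Measurable[Mo.mHS] (fun ω => conj (v ω (l, n))) :=
    Complex.continuous_conj.measurable.comp hvm'
  have hHij : ∀ j, Measurable[Mo.mHS] (fun ω => Mo.H ω (l, n) j) := fun j =>
    (measurable_pi_apply j).comp ((measurable_pi_apply (l, n)).comp hHm)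
  have hsp : ∀ j, Measurable[Mo.mHS] (fun ω => (Real.sqrt (Mo.p ω j) : ℂ)) := fun j =>
    Complex.continuous_ofReal.measurable.comp
      (Real.continuous_sqrt.measurable.comp ((measurable_pi_apply j).comp hpm))
  have hv4 : MemLp (fun ω => conj (v ω (l, n))) 4 ℙ := by
    refine memLp_four_of_integrable (hcv.mono hle le_rfl) hvi fun ω => ?_
    have h1 : ‖v ω (l, n)‖ ^ 2 ≤ ∑ n, ‖v ω (l, n)‖ ^ 2 :=
      Finset.single_le_sum (f := fun n => ‖v ω (l, n)‖ ^ 2)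
        (fun _ _ => by positivity) (Finset.mem_univ n)
    calc ‖conj (v ω (l, n))‖ ^ 4 = (‖v ω (l, n)‖ ^ 2) ^ 2 := by
          rw [RCLike.norm_conj]; ring
      _ ≤ _ := by gcongr
  have hH4 : ∀ j, MemLp (fun ω => Mo.H ω (l, n) j) 4 ℙ := fun j => by
    refine memLp_four_of_integrable ((hHij j).mono hle le_rfl) Mo.hHHherm_L2 fun ω => ?_
    have h1 : ‖Mo.H ω (l, n) j‖ ^ 2 ≤ ∑ j, ‖Mo.H ω (l, n) j‖ ^ 2 :=
      Finset.single_le_sum (f := fun j => ‖Mo.H ω (l, n) j‖ ^ 2)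
        (fun _ _ => by positivity) (Finset.mem_univ j)
    have h2 : (Matrix.of (Mo.H ω) * (Matrix.of (Mo.H ω))ᴴ) (l, n) (l, n)
        = ((∑ j, ‖Mo.H ω (l, n) j‖ ^ 2 : ℝ) : ℂ) := by
      simp [Matrix.mul_apply, Matrix.conjTranspose_apply, Complex.mul_conj']
    have h3 : (∑ j, ‖Mo.H ω (l, n) j‖ ^ 2) ^ 2
        = ‖(Matrix.of (Mo.H ω) * (Matrix.of (Mo.H ω))ᴴ) (l, n) (l, n)‖ ^ 2 := by
      rw [h2, Complex.norm_real, Real.norm_eq_abs, sq_abs]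
    calc ‖Mo.H ω (l, n) j‖ ^ 4 = (‖Mo.H ω (l, n) j‖ ^ 2) ^ 2 := by ring
      _ ≤ (∑ j, ‖Mo.H ω (l, n) j‖ ^ 2) ^ 2 := by gcongr
      _ = _ := h3
      _ ≤ ∑ i', ‖(Matrix.of (Mo.H ω) * (Matrix.of (Mo.H ω))ᴴ) (l, n) i'‖ ^ 2 :=
          Finset.single_le_sum
            (f := fun i' => ‖(Matrix.of (Mo.H ω) * (Matrix.of (Mo.H ω))ᴴ) (l, n) i'‖ ^ 2)
            (fun _ _ => by positivity) (Finset.mem_univ (l, n))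
      _ ≤ _ :=
          Finset.single_le_sum
            (f := fun i => ∑ i', ‖(Matrix.of (Mo.H ω) * (Matrix.of (Mo.H ω))ᴴ) i i'‖ ^ 2)
            (fun _ _ => Finset.sum_nonneg fun _ _ => sq_nonneg _) (Finset.mem_univ (l, n))
  obtain ⟨C, hC⟩ := Mo.hp_bdd
  have hspb : ∀ j, MemLp (fun ω => (Real.sqrt (Mo.p ω j) : ℂ)) ∞ ℙ := fun j => by
    refine memLp_top_of_bound ((hsp j).mono hle le_rfl).aestronglyMeasurable (Real.sqrt C) ?_
    filter_upwards [hC] with ω hω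
    rw [Complex.norm_real, Real.norm_of_nonneg (Real.sqrt_nonneg _)]
    exact Real.sqrt_le_sqrt (hω j)
  have hvH : ∀ j, MemLp (fun ω => conj (v ω (l, n)) * Mo.H ω (l, n) j) 2 ℙ := fun j => by
    have : ENNReal.HolderTriple 4 4 2 := ⟨by
      have h4 : (4 : ℝ≥0∞) = 2 * 2 := by norm_num
      rw [h4, ENNReal.mul_inv (by norm_num) (by norm_num), ← mul_add,
        ENNReal.inv_two_add_inv_two, mul_one]⟩
    exact MemLp.mul (p := 4) (q := 4) (r := 2) (hH4 j) hv4
  have hc : ∀ j, MemLp (fun ω => (Real.sqrt (Mo.p ω j) : ℂ) *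
      (conj (v ω (l, n)) * Mo.H ω (l, n) j)) 2 ℙ := fun j =>
    MemLp.mul (p := ∞) (q := 2) (r := 2) (hvH j) (hspb j)
  have hcm : ∀ j, Measurable[Mo.mHS] (fun ω => (Real.sqrt (Mo.p ω j) : ℂ) *
      (conj (v ω (l, n)) * Mo.H ω (l, n) j)) := fun j => (hsp j).mul (hcv.mul (hHij j))
  have hix : ∀ j, Indep Mo.mHS (MeasurableSpace.comap (Mo.x j) inferInstance) ℙ := fun j => by
    rw [mHS]
    have := Mo.hindep.indep (i := Sum.inr true) (j := Sum.inl j) (by simp)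
    simpa using this
  have hiz : Indep Mo.mHS (MeasurableSpace.comap Mo.z inferInstance) ℙ := by
    rw [mHS]
    have := Mo.hindep.indep (i := Sum.inr true) (j := Sum.inr false) (by simp)
    simpa using this
  have hterm : ∀ j, MemLp (fun ω => ((Real.sqrt (Mo.p ω j) : ℂ) *
      (conj (v ω (l, n)) * Mo.H ω (l, n) j)) * Mo.x j ω) 2 ℙ := fun j => by
    refine memLp_two_mul_of_indep (hc j) (Mo.hx_L2 j) ?_
    rw [IndepFun_iff_Indep]
    exact indep_of_indep_of_le_left (hix j) (hcm j).comap_le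
  have hzt : MemLp (fun ω => conj (v ω (l, n)) * Mo.z ω (l, n)) 2 ℙ := by
    refine memLp_two_mul_of_indep (hv4.mono_exponent (p := 2) (by norm_num)) (Mo.hz_L2 (l, n)) ?_
    rw [IndepFun_iff_Indep]
    refine indep_of_indep_of_le_left (indep_of_indep_of_le_right hiz ?_) hcv.comap_le
    exact Measurable.comap_le ((measurable_pi_apply (l, n)).comp (comap_measurable Mo.z))
  have := (memLp_finsetSum Finset.univ fun j _ => hterm j).add hzt
  refine (memLp_congr_ae (ae_of_all _ fun ω => ?_)).2 this
  simp only [r, Pi.add_apply, mul_add, Finset.mul_sum]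
  congr 1
  exact Finset.sum_congr rfl fun j _ => by ring

theorem minimizer_aux
    {Ω 𝓤 : Type*} [MeasurableSpace 𝓤] (U : Ω → 𝓤) [MeasureSpace Ω] [IsProbabilityMeasure (ℙ : Measure Ω)]
    {K N L : ℕ} {𝓢 : Fin L → Type*} [∀ l, MeasurableSpace (𝓢 l)]
    (Mo : DistUplinkModel Ω K N L 𝓢) (Lk : Finset (Fin L)) (k : Fin K)
    (hm : mU U ≤ MeasureSpace.toMeasurableSpace)
    (hUcommon : ∀ l ∈ Lk, mU U ≤ Mo.mS l)
    (vopt : Ω → Fin L × Fin N → ℂ) (hvopt : vopt ∈ Mo.Vset Lk) :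
    (∀ v ∈ Mo.Vset Lk, Mo.MSE k vopt ≤ Mo.MSE k v) ↔
      (∀ v ∈ Mo.Vset Lk, ∀ᵐ ω, Mo.MSEcond (mU U) k vopt ω ≤ Mo.MSEcond (mU U) k v ω) := by
  set f : (Ω → Fin L × Fin N → ℂ) → Ω → ℝ :=
    fun v ω => ‖Mo.x k ω - ∑ i, conj (v ω i) * Mo.r ω i‖ ^ 2 with hf
  have hint : ∀ v ∈ Mo.Vset Lk, Integrable (f v) ℙ := fun v hv => by
    have := Mo.memLp_err_aux Lk k v hv
    exact (memLp_two_iff_integrable_sq_norm this.aestronglyMeasurable).1 this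
  have hMSE : ∀ v, Mo.MSE k v = ∫ ω, Mo.MSEcond (mU U) k v ω := fun v =>
    (integral_condExp hm).symm
  have hci : ∀ v, Integrable (Mo.MSEcond (mU U) k v) := fun v => integrable_condExp
  constructor
  · intro h v hv
    have hsm : ∀ v, Measurable[mU U] (Mo.MSEcond (mU U) k v) := fun v =>
      stronglyMeasurable_condExp.measurable
    set A : Set Ω := {ω | Mo.MSEcond (mU U) k v ω < Mo.MSEcond (mU U) k vopt ω} with hA
    have hAm : MeasurableSet[mU U] A := measurableSet_lt (hsm v) (hsm vopt)
    classical
    set w : Ω → Fin L × Fin N → ℂ := fun ω => if ω ∈ A then v ω else vopt ω with hw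
    have hwV : w ∈ Mo.Vset Lk := by
      refine ⟨fun l hl => ⟨?_, ?_⟩, fun l hl => ?_⟩
      · have hAl : MeasurableSet[Mo.mS l] A := hUcommon l hl A hAm
        have := @Measurable.ite _ _ _ _ (Mo.mS l) _ (fun ω => ω ∈ A) (Classical.decPred _) hAl
          (hv.1 l hl).1 (hvopt.1 l hl).1
        convert this using 2 with ω
        by_cases hω : ω ∈ A <;> simp [hw, hω]
      · have := ((hv.1 l hl).2.indicator (hm _ hAm)).add
          ((hvopt.1 l hl).2.indicator (hm _ hAm).compl)
        refine this.congr (ae_of_all _ fun ω => ?_)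
        by_cases hω : ω ∈ A <;> simp [hw, hω]
      · filter_upwards [hv.2 l hl, hvopt.2 l hl] with ω h1 h2 n
        by_cases hω : ω ∈ A <;> simp [hw, hω, h1, h2]
    have hfw : f w = A.indicator (f v) + Aᶜ.indicator (f vopt) := by
      funext ω
      by_cases hω : ω ∈ A <;> simp [hf, hw, hω]
    have h1 : ∫ ω, f w ω = (∫ ω in A, f v ω) + ∫ ω in Aᶜ, f vopt ω := by
      rw [hfw, integral_add' ((hint v hv).indicator (hm _ hAm))
        ((hint vopt hvopt).indicator (hm _ hAm).compl),
        integral_indicator (hm _ hAm), integral_indicator (hm _ hAm).compl]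
    have h2 : (∫ ω in A, f vopt ω) + ∫ ω in Aᶜ, f vopt ω = ∫ ω, f vopt ω :=
      integral_add_compl (hm _ hAm) (hint vopt hvopt)
    have h3 : ∫ ω, f vopt ω ≤ ∫ ω, f w ω := h w hwV
    have h4 : ∫ ω in A, Mo.MSEcond (mU U) k v ω = ∫ ω in A, f v ω :=
      setIntegral_condExp hm (hint v hv) hAm
    have h5 : ∫ ω in A, Mo.MSEcond (mU U) k vopt ω = ∫ ω in A, f vopt ω :=
      setIntegral_condExp hm (hint vopt hvopt) hAm
    set D : Ω → ℝ := A.indicator (Mo.MSEcond (mU U) k vopt - Mo.MSEcond (mU U) k v) with hD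
    have hD0 : 0 ≤ D := fun ω => Set.indicator_nonneg
      (fun ω hω => sub_nonneg.2 (le_of_lt hω)) ω
    have hDi : Integrable D := ((hci vopt).sub (hci v)).indicator (hm _ hAm)
    have hDint : ∫ ω, D ω = 0 := by
      refine le_antisymm ?_ (integral_nonneg hD0)
      rw [hD, integral_indicator (hm _ hAm),
        integral_sub' (hci vopt).integrableOn (hci v).integrableOn]
      linarith
    have hz := (integral_eq_zero_iff_of_nonneg hD0 hDi).1 hDint
    filter_upwards [hz] with ω hω
    by_contra hlt
    have hωA : ω ∈ A := not_le.1 hlt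
    have hlt' : Mo.MSEcond (mU U) k v ω < Mo.MSEcond (mU U) k vopt ω := hωA
    rw [hD, Set.indicator_of_mem hωA] at hω
    simp only [Pi.sub_apply, Pi.zero_apply] at hω
    linarith
  · intro h v hv
    rw [hMSE, hMSE]
    exact integral_mono_ae (hci vopt) (hci v) (h v hv)

end DistUplinkModel

/-- If the decoder side information `U` is common beamforming CSI
(a measurable function of `S_l` for every `l` in the serving cluster) and a measurable
function of `(H, S)`, and `p` is `σ(S_l)`-measurable for every `l` in the serving cluster,
then `vopt ∈ 𝒱_k` attains `inf_{v ∈ 𝒱_k} MSE_k(v)` if and only if `vopt` attains the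
essential infimum of the family of conditional MSEs `{MSE_k(v|U) : v ∈ 𝒱_k}`. -/
theorem mse_minimizer_iff_conditional_mse_minimizer
    {Ω : Type*} [MeasureSpace Ω] [IsProbabilityMeasure (ℙ : Measure Ω)]
    {K N L : ℕ} {𝓢 : Fin L → Type*} [∀ l, MeasurableSpace (𝓢 l)]
    {𝓤 : Type*} [MeasurableSpace 𝓤]
    (Mo : DistUplinkModel Ω K N L 𝓢) (Lk : Finset (Fin L)) (k : Fin K)
    (U : Ω → 𝓤) (hU : Measurable U)
    (hUcommon : ∀ l ∈ Lk,
      MeasurableSpace.comap U inferInstance ≤ Mo.mS l)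
    (hUHS : MeasurableSpace.comap U inferInstance ≤
      MeasurableSpace.comap (fun ω => (Mo.H ω, fun l => Mo.S l ω)) inferInstance)
    (hp : ∀ l ∈ Lk, Measurable[Mo.mS l] Mo.p)
    (vopt : Ω → Fin L × Fin N → ℂ) (hvopt : vopt ∈ Mo.Vset Lk) :
    (∀ v ∈ Mo.Vset Lk, Mo.MSE k vopt ≤ Mo.MSE k v) ↔
      (∀ v ∈ Mo.Vset Lk, ∀ᵐ ω,
        Mo.MSEcond (MeasurableSpace.comap U inferInstance) k vopt ω ≤
          Mo.MSEcond (MeasurableSpace.comap U inferInstance) k v ω) := by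
  exact Mo.minimizer_aux U Lk k hU.comap_le hUcommon vopt hvopt
end
end

section
/- Let H : Ω → ℂ^{M×K} be a random matrix with square-integrable entries, S a random element, and p : Ω → [0, ∞)^K σ(S)-measurable and essentially bounded. Set Ĥ := E[H | σ(S)] (entrywise conditional expectation) and H̃ := H − Ĥ, with columns h̃_1, …, h̃_K. If H̃ is independent of S, then almost surely E[H P Hᴴ | σ(S)] = Ĥ P Ĥᴴ + Σ_{j=1}^{K} p_j E[h̃_j h̃_jᴴ], where P := diag(p_1, …, p_K). -/
open MeasureTheory ProbabilityTheory Matrix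
open scoped ENNReal ComplexConjugate MeasureTheory

noncomputable section

lemma scalar_decomp {Ω : Type*} {m m0 : MeasurableSpace Ω} {μ : Measure Ω}
    [IsProbabilityMeasure μ] (hm : m ≤ m0) {X Y Xh Yh : Ω → ℂ}
    (hX : MemLp X 2 μ) (hY : MemLp Y 2 μ) (hXh : Xh = μ[X | m]) (hYh : Yh = μ[Y | m])
    {q : Ω → ℝ} (hq : StronglyMeasurable[m] q) {C : ℝ} (hC : ∀ᵐ ω ∂μ, ‖q ω‖ ≤ C) {c : ℂ}
    (hc : μ[fun ω => (X ω - Xh ω) * conj (Y ω - Yh ω) | m] =ᵐ[μ] fun _ => c) :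
    Integrable (fun ω => q ω • (X ω * conj (Y ω))) μ ∧
    μ[fun ω => q ω • (X ω * conj (Y ω)) | m] =ᵐ[μ]
      fun ω => q ω • (Xh ω * conj (Yh ω) + c) := by
  have h12 : (1 : ℝ≥0∞) ≤ 2 := by norm_num
  have mXh : MemLp Xh 2 μ := hXh ▸ hX.condExp h12
  have mYh : MemLp Yh 2 μ := hYh ▸ hY.condExp h12
  have sXh : StronglyMeasurable[m] Xh := hXh ▸ stronglyMeasurable_condExp
  have sYh : StronglyMeasurable[m] Yh := hYh ▸ stronglyMeasurable_condExp
  have sYhc : StronglyMeasurable[m] (fun ω => conj (Yh ω)) :=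
    Complex.continuous_conj.comp_stronglyMeasurable sYh
  have cond0 : ∀ {Z Zh : Ω → ℂ}, MemLp Z 2 μ → Zh = μ[Z | m] →
      μ[fun ω => Z ω - Zh ω | m] =ᵐ[μ] 0 := by
    intro Z Zh hZ hZh
    have h1 : Integrable Zh μ := hZh ▸ integrable_condExp
    have h2 : μ[Zh | m] = Zh :=
      condExp_of_stronglyMeasurable hm (hZh ▸ stronglyMeasurable_condExp) h1
    refine (condExp_sub (hZ.integrable h12) h1 m).trans ?_
    rw [h2, ← hZh, sub_self]
  have mXt : MemLp (fun ω => X ω - Xh ω) 2 μ := hX.sub mXh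
  have mYt : MemLp (fun ω => Y ω - Yh ω) 2 μ := hY.sub mYh
  have mYtc : MemLp (fun ω => conj (Y ω - Yh ω)) 2 μ := mYt.star
  have mYhc : MemLp (fun ω => conj (Yh ω)) 2 μ := mYh.star
  have mYc : MemLp (fun ω => conj (Y ω)) 2 μ := hY.star
  have i0 : Integrable (fun ω => X ω * conj (Y ω)) μ := hX.integrable_mul mYc
  have i1 : Integrable (fun ω => Xh ω * conj (Yh ω)) μ := mXh.integrable_mul mYhc
  have i2 : Integrable (fun ω => Xh ω * conj (Y ω - Yh ω)) μ := mXh.integrable_mul mYtc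
  have i3 : Integrable (fun ω => (X ω - Xh ω) * conj (Yh ω)) μ := mXt.integrable_mul mYhc
  have i4 : Integrable (fun ω => (X ω - Xh ω) * conj (Y ω - Yh ω)) μ := mXt.integrable_mul mYtc
  have e1 : μ[fun ω => Xh ω * conj (Yh ω) | m] = fun ω => Xh ω * conj (Yh ω) :=
    condExp_of_stronglyMeasurable hm (sXh.mul sYhc) i1
  have eY : μ[fun ω => conj (Y ω - Yh ω) | m] =ᵐ[μ] 0 := by
    have h := (Complex.conjCLE : ℂ →L[ℝ] ℂ).comp_condExp_comm (m := m) (mYt.integrable h12)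
    refine Filter.EventuallyEq.trans h.symm ?_
    filter_upwards [cond0 hY hYh] with ω hω
    simp [hω]
  have e2 : μ[fun ω => Xh ω * conj (Y ω - Yh ω) | m] =ᵐ[μ] 0 := by
    have h := condExp_bilin_of_stronglyMeasurable_left (ContinuousLinearMap.mul ℝ ℂ) sXh i2
      (mYtc.integrable h12)
    refine Filter.EventuallyEq.trans h ?_
    filter_upwards [eY] with ω hω
    rw [hω]; simp
  have e3 : μ[fun ω => (X ω - Xh ω) * conj (Yh ω) | m] =ᵐ[μ] 0 := by
    have h := condExp_bilin_of_stronglyMeasurable_right (ContinuousLinearMap.mul ℝ ℂ) sYhc i3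
      (mXt.integrable h12)
    refine Filter.EventuallyEq.trans h ?_
    filter_upwards [cond0 hX hXh] with ω hω
    simp [hω]
  have dec : (fun ω => X ω * conj (Y ω)) =
      ((fun ω => Xh ω * conj (Yh ω)) + fun ω => Xh ω * conj (Y ω - Yh ω)) +
      ((fun ω => (X ω - Xh ω) * conj (Yh ω)) +
        fun ω => (X ω - Xh ω) * conj (Y ω - Yh ω)) := by
    ext ω
    simp only [Pi.add_apply, map_sub]
    ring
  have e0 : μ[fun ω => X ω * conj (Y ω) | m] =ᵐ[μ] fun ω => Xh ω * conj (Yh ω) + c := by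
    rw [dec]
    filter_upwards [condExp_add (i1.add i2) (i3.add i4) m, condExp_add i1 i2 m,
      condExp_add i3 i4 m, e2, e3, hc] with ω h1 h2 h3 h4 h5 h6
    rw [h1, Pi.add_apply, h2, h3, Pi.add_apply, Pi.add_apply, h4, h5, h6, e1]
    simp
  have iq : Integrable (fun ω => q ω • (X ω * conj (Y ω))) μ :=
    i0.bdd_smul C (hq.mono hm).aestronglyMeasurable hC
  refine ⟨iq, ?_⟩
  refine (condExp_smul_of_aestronglyMeasurable_left hq.aestronglyMeasurable iq i0).trans ?_
  filter_upwards [e0] with ω hω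
  simp [hω]

/-- Let `H` be a random `M × K` complex matrix with square-integrable
entries, `S` a random element, and `p : Ω → [0, ∞)^K` a `σ(S)`-measurable essentially
bounded power vector. Set `Ĥ := E[H | σ(S)]` (entrywise) and `H̃ := H − Ĥ`. If `H̃` is
independent of `S`, then almost surely
`E[H P Hᴴ | σ(S)] = Ĥ P Ĥᴴ + ∑_j p_j E[h̃_j h̃_jᴴ]`, where `P = diag(p)`. -/
theorem condexp_HPH_decomposition
    {Ω : Type*} [MeasureSpace Ω] [IsProbabilityMeasure (ℙ : Measure Ω)]
    {M K : ℕ} {𝓢 : Type*} [MeasurableSpace 𝓢]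
    (H : Ω → Fin M → Fin K → ℂ) (hH : Measurable H)
    (hHL2 : ∀ i j, MemLp (fun ω => H ω i j) 2 ℙ)
    (S : Ω → 𝓢) (hS : Measurable S)
    (p : Ω → Fin K → ℝ) (hp0 : ∀ ω j, 0 ≤ p ω j)
    (hpmeas : Measurable[MeasurableSpace.comap S inferInstance] p)
    (hpbdd : ∃ C : ℝ, ∀ᵐ ω, ∀ j, p ω j ≤ C)
    (Hhat : Ω → Matrix (Fin M) (Fin K) ℂ)
    (hHhat : ∀ i j, (fun ω => Hhat ω i j) =
      ℙ[fun ω => H ω i j | MeasurableSpace.comap S inferInstance])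
    (hindep : IndepFun (fun ω (i : Fin M) (j : Fin K) => H ω i j - Hhat ω i j) S ℙ) :
    ∀ᵐ ω, (Matrix.of fun i i' =>
        (ℙ[fun ω' => (Matrix.of (H ω') * Matrix.diagonal (fun j => (p ω' j : ℂ)) *
            (Matrix.of (H ω'))ᴴ) i i' | MeasurableSpace.comap S inferInstance]) ω) =
      Hhat ω * Matrix.diagonal (fun j => (p ω j : ℂ)) * (Hhat ω)ᴴ
        + ∑ j, (p ω j : ℂ) • Matrix.of fun i i' =>
            ∫ ω', (Matrix.of (H ω') - Hhat ω') i j * conj ((Matrix.of (H ω') - Hhat ω') i' j) := by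
  obtain ⟨C, hC⟩ := hpbdd
  have hm : MeasurableSpace.comap S inferInstance ≤ (inferInstance : MeasurableSpace Ω) :=
    hS.comap_le
  have hmeas : Measurable (fun ω (i : Fin M) (j : Fin K) => H ω i j - Hhat ω i j) := by
    refine measurable_pi_lambda _ fun i => measurable_pi_lambda _ fun j => ?_
    refine Measurable.sub (by fun_prop) ?_
    rw [hHhat i j]
    exact (stronglyMeasurable_condExp.mono hm).measurable
  have key := fun (i i' : Fin M) (j : Fin K) =>
    scalar_decomp (μ := ℙ) hm (hHL2 i j) (hHL2 i' j) (hHhat i j) (hHhat i' j)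
      (q := fun ω => p ω j) (C := C)
      (((measurable_pi_apply j).comp hpmeas).stronglyMeasurable)
      (by filter_upwards [hC] with ω hω; rw [Real.norm_of_nonneg (hp0 ω j)]; exact hω j)
      (c := ∫ ω', (H ω' i j - Hhat ω' i j) * conj (H ω' i' j - Hhat ω' i' j))
      (condExp_indep_eq hmeas.comap_le hm
        (by
          have h1 : Measurable (fun A : Fin M → Fin K → ℂ => A i j * conj (A i' j)) := by
            have := Complex.continuous_conj.measurable
            fun_prop
          exact (h1.comp (comap_measurable _)).stronglyMeasurable)
        ((IndepFun_iff_Indep _ _ _).1 hindep))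
  have main : ∀ i i' : Fin M, ∀ᵐ ω,
      (ℙ[fun ω' => (Matrix.of (H ω') * Matrix.diagonal (fun j => (p ω' j : ℂ)) *
            (Matrix.of (H ω'))ᴴ) i i' | MeasurableSpace.comap S inferInstance]) ω =
      ∑ j, p ω j • (Hhat ω i j * conj (Hhat ω i' j) +
        ∫ ω', (H ω' i j - Hhat ω' i j) * conj (H ω' i' j - Hhat ω' i' j)) := by
    intro i i'
    have hfun : (fun ω' => (Matrix.of (H ω') * Matrix.diagonal (fun j => (p ω' j : ℂ)) *
            (Matrix.of (H ω'))ᴴ) i i') =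
        ∑ j, fun ω' => p ω' j • (H ω' i j * conj (H ω' i' j)) := by
      ext ω
      rw [Matrix.mul_apply, Finset.sum_apply]
      refine Finset.sum_congr rfl fun j _ => ?_
      simp [Matrix.mul_diagonal, Matrix.conjTranspose_apply]
      ring
    rw [hfun]
    have hall := ae_all_iff.2 fun j => (key i i' j).2
    filter_upwards [hall, condExp_finsetSum (s := Finset.univ)
      (fun j _ => (key i i' j).1) (MeasurableSpace.comap S inferInstance)] with ω h1 h2
    rw [h2, Finset.sum_apply]
    exact Finset.sum_congr rfl fun j _ => h1 j
  filter_upwards [ae_all_iff.2 fun i => ae_all_iff.2 fun i' => main i i'] with ω h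
  ext i i'
  rw [Matrix.of_apply, h i i', Matrix.add_apply, Matrix.mul_apply, Matrix.sum_apply,
    ← Finset.sum_add_distrib]
  refine Finset.sum_congr rfl fun j _ => ?_
  simp [Matrix.mul_diagonal, Matrix.conjTranspose_apply]
  ring
end
end

section
/- Let H_l : Ω → ℂ^{N×K} and H_j : Ω → ℂ^{N×K} be random matrices with essentially bounded entries, S_l and S_j random elements, v_j : Ω → ℂ^N σ(S_j)-measurable and essentially bounded, and p : Ω → [0, ∞)^K σ(S_l)-measurable and essentially bounded; set P := diag(p). Assume: (i) H_l and H_j are conditionally independent given σ(S_l, S_j); (ii) E[H_l | σ(S_l, S_j)] = E[H_l | σ(S_l)] a.s.; and (iii) E[H_j | σ(S_l, S_j)] = E[H_j | σ(S_j)] a.s. Then, almost surely, E[H_l P H_jᴴ v_j | σ(S_l)] = E[H_l | σ(S_l)] · P · E[ E[H_j | σ(S_j)]ᴴ v_j | σ(S_l) ]. -/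
open MeasureTheory ProbabilityTheory Matrix
open scoped ENNReal ComplexConjugate MeasureTheory

noncomputable section

/-- Conditionally independent integrable complex random variables have multiplicative
conditional expectation. -/
lemma condExp_mul_of_condIndepFun_aux {Ω : Type*} {m mΩ : MeasurableSpace Ω}
    [StandardBorelSpace Ω] {μ : Measure Ω} [IsFiniteMeasure μ] (hm : m ≤ mΩ)
    {f g : Ω → ℂ} (hf : Measurable f) (hg : Measurable g)
    (hfi : Integrable f μ) (hgi : Integrable g μ)
    (hfg : Integrable (fun ω => f ω * g ω) μ)
    (h : CondIndepFun m hm f g μ) :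
    μ[fun ω => f ω * g ω | m] =ᵐ[μ] fun ω => (μ[f | m]) ω * (μ[g | m]) ω := by
  have h1 := (condIndepFun_iff_map_prod_eq_prod_map_map hf hg).1 h
  have h2 := ae_eq_of_ae_eq_trim h1
  filter_upwards [h2, condExp_ae_eq_integral_condExpKernel hm hfi,
    condExp_ae_eq_integral_condExpKernel hm hgi,
    condExp_ae_eq_integral_condExpKernel hm hfg] with ω hω ef eg efg
  rw [ef, eg, efg]
  rw [Kernel.map_apply _ (hf.prodMk hg), Kernel.prod_apply, Kernel.map_apply _ hf,
    Kernel.map_apply _ hg] at hω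
  have hi : IndepFun f g (condExpKernel μ m ω) :=
    (indepFun_iff_map_prod_eq_prod_map_map hf.aemeasurable hg.aemeasurable).2 hω
  exact hi.integral_fun_mul_eq_mul_integral hf.aestronglyMeasurable hg.aestronglyMeasurable

/-- Scalar version of the factorization. -/
lemma condExp_scalar_factorization_aux {Ω : Type*} {m₁ m₂ m₃ mΩ : MeasurableSpace Ω}
    [StandardBorelSpace Ω] {μ : Measure Ω} [IsFiniteMeasure μ]
    (h12 : m₁ ≤ m₂) (h32 : m₃ ≤ m₂) (hm : m₂ ≤ mΩ)
    {f g p v : Ω → ℂ} (hf : Measurable f) (hg : Measurable g)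
    (hp : Measurable[m₁] p) (hv : Measurable[m₃] v)
    {Cf Cg Cp Cv : ℝ} (bf : ∀ᵐ ω ∂μ, ‖f ω‖ ≤ Cf) (bg : ∀ᵐ ω ∂μ, ‖g ω‖ ≤ Cg)
    (bp : ∀ᵐ ω ∂μ, ‖p ω‖ ≤ Cp) (bv : ∀ᵐ ω ∂μ, ‖v ω‖ ≤ Cv)
    (h : CondIndepFun m₂ hm f g μ)
    (hMf : μ[f | m₂] =ᵐ[μ] μ[f | m₁]) (hMg : μ[g | m₂] =ᵐ[μ] μ[g | m₃]) :
    Integrable (fun ω => f ω * p ω * star (g ω) * v ω) μ ∧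
    Integrable (fun ω => star ((μ[g | m₃]) ω) * v ω) μ ∧
    μ[fun ω => f ω * p ω * star (g ω) * v ω | m₁] =ᵐ[μ]
      fun ω => (μ[f | m₁]) ω * (p ω *
        (μ[fun ω' => star ((μ[g | m₃]) ω') * v ω' | m₁]) ω) := by
  have hp2 : Measurable[m₂] p := hp.mono h12 le_rfl
  have hv2 : Measurable[m₂] v := hv.mono h32 le_rfl
  have hpΩ : Measurable p := hp2.mono hm le_rfl
  have hvΩ : Measurable v := hv2.mono hm le_rfl
  have hgs : Measurable (fun ω => star (g ω)) := continuous_star.measurable.comp hg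
  have fi : Integrable f μ := .of_bound hf.aestronglyMeasurable Cf bf
  have gi : Integrable g μ := .of_bound hg.aestronglyMeasurable Cg bg
  have bgs : ∀ᵐ ω ∂μ, ‖star (g ω)‖ ≤ Cg := by simpa using bg
  have gsi : Integrable (fun ω => star (g ω)) μ := .of_bound hgs.aestronglyMeasurable Cg bgs
  have fgi : Integrable (fun ω => f ω * star (g ω)) μ :=
    gsi.bdd_mul hf.aestronglyMeasurable bf
  have vfgi : Integrable (fun ω => v ω * (f ω * star (g ω))) μ :=
    fgi.bdd_mul hvΩ.aestronglyMeasurable bv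
  have pvfgi : Integrable (fun ω => p ω * (v ω * (f ω * star (g ω)))) μ :=
    vfgi.bdd_mul hpΩ.aestronglyMeasurable bp
  have e0 : (fun ω => f ω * p ω * star (g ω) * v ω)
      = fun ω => p ω * (v ω * (f ω * star (g ω))) := by
    funext ω; ring
  have cstar : μ[fun ω => star (g ω) | m₂] =ᵐ[μ] fun ω => star ((μ[g | m₂]) ω) :=
    (ContinuousLinearMap.comp_condExp_comm (m := m₂) gi
      (Complex.conjCLE : ℂ →L[ℝ] ℂ)).symm
  have hsi : CondIndepFun m₂ hm f (fun ω => star (g ω)) μ :=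
    h.comp (φ := id) (ψ := star) measurable_id continuous_star.measurable
  have e1 := condExp_mul_of_condIndepFun_aux hm hf hgs fi gsi fgi hsi
  have e2 : μ[fun ω => v ω * (f ω * star (g ω)) | m₂] =ᵐ[μ] fun ω =>
      v ω * (μ[fun ω => f ω * star (g ω) | m₂]) ω :=
    condExp_bilin_of_stronglyMeasurable_left (.mul ℝ ℂ) hv2.stronglyMeasurable vfgi fgi
  have e3 : μ[fun ω => p ω * (v ω * (f ω * star (g ω))) | m₂] =ᵐ[μ] fun ω =>
      p ω * (μ[fun ω => v ω * (f ω * star (g ω)) | m₂]) ω :=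
    condExp_bilin_of_stronglyMeasurable_left (.mul ℝ ℂ) hp2.stronglyMeasurable pvfgi vfgi
  have Yi : Integrable (fun ω => star ((μ[g | m₃]) ω) * v ω) μ := by
    have : Integrable (fun ω => star ((μ[g | m₃]) ω)) μ :=
      (Complex.conjCLE : ℂ →L[ℝ] ℂ).integrable_comp integrable_condExp
    exact this.mul_bdd hvΩ.aestronglyMeasurable bv
  have e4 : μ[fun ω => p ω * (v ω * (f ω * star (g ω))) | m₂] =ᵐ[μ] fun ω =>
      ((μ[f | m₁]) ω * p ω) * (star ((μ[g | m₃]) ω) * v ω) := by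
    filter_upwards [e1, e2, e3, cstar, hMf, hMg] with ω a1 a2 a3 a4 a5 a6
    rw [a3, a2, a1, a4, a5, a6]; ring
  have e5 : μ[fun ω => ((μ[f | m₁]) ω * p ω) * (star ((μ[g | m₃]) ω) * v ω) | m₁]
      =ᵐ[μ] fun ω => ((μ[f | m₁]) ω * p ω) *
        (μ[fun ω' => star ((μ[g | m₃]) ω') * v ω' | m₁]) ω :=
    condExp_bilin_of_stronglyMeasurable_left (.mul ℝ ℂ)
      (stronglyMeasurable_condExp.mul hp.stronglyMeasurable)
      (integrable_condExp.congr e4) Yi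
  rw [e0]
  refine ⟨pvfgi, Yi, ?_⟩
  refine (condExp_condExp_of_le h12 hm).symm.trans ((condExp_congr_ae e4).trans ?_)
  filter_upwards [e5] with ω h5
  rw [h5]; ring

/-- Under conditional independence of the local channels `H_l`, `H_j` given
`σ(S_l, S_j)` and the Markov-type conditions
`E[H_l | σ(S_l, S_j)] = E[H_l | σ(S_l)]` and `E[H_j | σ(S_l, S_j)] = E[H_j | σ(S_j)]`,
one has, almost surely,
`E[H_l P H_jᴴ v_j | σ(S_l)] = E[H_l | σ(S_l)] · P · E[E[H_j | σ(S_j)]ᴴ v_j | σ(S_l)]`. -/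
theorem condexp_cross_term_factorization
    {Ω : Type*} [MeasureSpace Ω] [StandardBorelSpace Ω]
    [IsProbabilityMeasure (ℙ : Measure Ω)]
    {N K : ℕ} {𝓢l 𝓢j : Type*} [MeasurableSpace 𝓢l] [MeasurableSpace 𝓢j]
    (Hl Hj : Ω → Fin N → Fin K → ℂ) (hHl : Measurable Hl) (hHj : Measurable Hj)
    (hHlbdd : ∃ C : ℝ, ∀ᵐ ω, ∀ n q, ‖Hl ω n q‖ ≤ C)
    (hHjbdd : ∃ C : ℝ, ∀ᵐ ω, ∀ n q, ‖Hj ω n q‖ ≤ C)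
    (Sl : Ω → 𝓢l) (Sj : Ω → 𝓢j) (hSl : Measurable Sl) (hSj : Measurable Sj)
    (vj : Ω → Fin N → ℂ)
    (hvjmeas : Measurable[MeasurableSpace.comap Sj inferInstance] vj)
    (hvjbdd : ∃ C : ℝ, ∀ᵐ ω, ∀ n, ‖vj ω n‖ ≤ C)
    (p : Ω → Fin K → ℝ) (hp0 : ∀ ω q, 0 ≤ p ω q)
    (hpmeas : Measurable[MeasurableSpace.comap Sl inferInstance] p)
    (hpbdd : ∃ C : ℝ, ∀ᵐ ω, ∀ q, p ω q ≤ C)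
    (hCI : CondIndepFun
      (MeasurableSpace.comap (fun ω => (Sl ω, Sj ω)) inferInstance)
      ((hSl.prodMk hSj).comap_le) Hl Hj ℙ)
    (hMarkovl : ∀ n q,
      (ℙ[fun ω => Hl ω n q |
          MeasurableSpace.comap (fun ω => (Sl ω, Sj ω)) inferInstance]) =ᵐ[ℙ]
      (ℙ[fun ω => Hl ω n q | MeasurableSpace.comap Sl inferInstance]))
    (hMarkovj : ∀ n q,
      (ℙ[fun ω => Hj ω n q |
          MeasurableSpace.comap (fun ω => (Sl ω, Sj ω)) inferInstance]) =ᵐ[ℙ]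
      (ℙ[fun ω => Hj ω n q | MeasurableSpace.comap Sj inferInstance])) :
    ∀ᵐ ω, (fun n =>
        (ℙ[fun ω' => ((Matrix.of (Hl ω') * Matrix.diagonal (fun q => (p ω' q : ℂ)) *
            (Matrix.of (Hj ω'))ᴴ) *ᵥ vj ω') n |
          MeasurableSpace.comap Sl inferInstance]) ω) =
      (Matrix.of fun n q => (ℙ[fun ω' => Hl ω' n q |
          MeasurableSpace.comap Sl inferInstance]) ω) *ᵥ
        (Matrix.diagonal (fun q => (p ω q : ℂ)) *ᵥ fun q =>
          (ℙ[fun ω' => ((Matrix.of fun n' q' => (ℙ[fun ω'' => Hj ω'' n' q' |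
                MeasurableSpace.comap Sj inferInstance]) ω')ᴴ *ᵥ vj ω') q |
            MeasurableSpace.comap Sl inferInstance]) ω) := by
  obtain ⟨Cl, hCl⟩ := hHlbdd
  obtain ⟨Cj, hCj⟩ := hHjbdd
  obtain ⟨Cv, hCv⟩ := hvjbdd
  obtain ⟨Cp, hCp⟩ := hpbdd
  have h12 : MeasurableSpace.comap Sl inferInstance ≤
      MeasurableSpace.comap (fun ω => (Sl ω, Sj ω)) inferInstance := by
    have : Measurable[MeasurableSpace.comap (fun ω => (Sl ω, Sj ω)) inferInstance] Sl :=
      measurable_fst.comp (comap_measurable (fun ω => (Sl ω, Sj ω)))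
    exact this.comap_le
  have h32 : MeasurableSpace.comap Sj inferInstance ≤
      MeasurableSpace.comap (fun ω => (Sl ω, Sj ω)) inferInstance := by
    have : Measurable[MeasurableSpace.comap (fun ω => (Sl ω, Sj ω)) inferInstance] Sj :=
      measurable_snd.comp (comap_measurable (fun ω => (Sl ω, Sj ω)))
    exact this.comap_le
  have key := fun (n i : Fin N) (q : Fin K) =>
    condExp_scalar_factorization_aux (μ := (ℙ : Measure Ω)) h12 h32
      ((hSl.prodMk hSj).comap_le)
      (f := fun ω => Hl ω n q) (g := fun ω => Hj ω i q)
      (p := fun ω => (p ω q : ℂ)) (v := fun ω => vj ω i)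
      (by fun_prop) (by fun_prop)
      (Complex.measurable_ofReal.comp ((measurable_pi_apply q).comp hpmeas))
      ((measurable_pi_apply i).comp hvjmeas)
      (hCl.mono fun ω h => h n q) (hCj.mono fun ω h => h i q)
      (Cp := Cp) (hCp.mono fun ω h => by
        rw [Complex.norm_real, Real.norm_of_nonneg (hp0 ω q)]; exact h q)
      (hCv.mono fun ω h => h i)
      (hCI.comp (φ := fun H : Fin N → Fin K → ℂ => H n q)
        (ψ := fun H : Fin N → Fin K → ℂ => H i q) (by fun_prop) (by fun_prop))
      (hMarkovl n q) (hMarkovj i q)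
  have lhs : ∀ n, (ℙ[fun ω' => ((Matrix.of (Hl ω') *
      Matrix.diagonal (fun q => (p ω' q : ℂ)) * (Matrix.of (Hj ω'))ᴴ) *ᵥ vj ω') n |
          MeasurableSpace.comap Sl inferInstance]) =ᵐ[ℙ] fun ω =>
      ∑ x : Fin N × Fin K, (ℙ[fun ω' => Hl ω' n x.2 * (p ω' x.2 : ℂ) * star (Hj ω' x.1 x.2)
        * vj ω' x.1 | MeasurableSpace.comap Sl inferInstance]) ω := by
    intro n
    have e : (fun ω' => ((Matrix.of (Hl ω') *
      Matrix.diagonal (fun q => (p ω' q : ℂ)) * (Matrix.of (Hj ω'))ᴴ) *ᵥ vj ω') n)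
        = ∑ x : Fin N × Fin K, fun ω' => Hl ω' n x.2 * (p ω' x.2 : ℂ) * star (Hj ω' x.1 x.2)
          * vj ω' x.1 := by
      funext ω'
      simp only [Finset.sum_apply, Fintype.sum_prod_type, Matrix.mulVec, dotProduct]
      refine Finset.sum_congr rfl fun i _ => ?_
      rw [Matrix.mul_apply, Finset.sum_mul]
      refine Finset.sum_congr rfl fun q _ => ?_
      rw [Matrix.mul_diagonal]
      rfl
    rw [e]
    refine (condExp_finsetSum (fun x _ => (key n x.1 x.2).1) _).trans ?_
    filter_upwards with ω
    simp
  have rhs : ∀ q, (ℙ[fun ω' => ((Matrix.of fun n' q' => (ℙ[fun ω'' => Hj ω'' n' q' |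
                MeasurableSpace.comap Sj inferInstance]) ω')ᴴ *ᵥ vj ω') q |
            MeasurableSpace.comap Sl inferInstance]) =ᵐ[ℙ] fun ω =>
      ∑ i : Fin N, (ℙ[fun ω' => star ((ℙ[fun ω'' => Hj ω'' i q |
          MeasurableSpace.comap Sj inferInstance]) ω') * vj ω' i |
            MeasurableSpace.comap Sl inferInstance]) ω := by
    intro q
    have e : (fun ω' => ((Matrix.of fun n' q' => (ℙ[fun ω'' => Hj ω'' n' q' |
                MeasurableSpace.comap Sj inferInstance]) ω')ᴴ *ᵥ vj ω') q)
        = ∑ i : Fin N, fun ω' => star ((ℙ[fun ω'' => Hj ω'' i q |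
          MeasurableSpace.comap Sj inferInstance]) ω') * vj ω' i := by
      funext ω'
      simp only [Finset.sum_apply, Matrix.mulVec, dotProduct]
      rfl
    rw [e]
    by_cases hN : Nonempty (Fin N)
    · obtain ⟨n⟩ := hN
      refine (condExp_finsetSum (fun i _ => (key n i q).2.1) _).trans ?_
      filter_upwards with ω
      simp
    · have : IsEmpty (Fin N) := not_nonempty_iff.1 hN
      simp
      rfl
  have keyae := ae_all_iff.2 fun n => ae_all_iff.2 fun i => ae_all_iff.2 fun q => (key n i q).2.2
  filter_upwards [ae_all_iff.2 lhs, ae_all_iff.2 rhs, keyae] with ω hl hr hk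
  funext n
  rw [hl n, Fintype.sum_prod_type_right]
  simp only [Matrix.mulVec_diagonal, Matrix.mulVec, dotProduct, Matrix.of_apply]
  refine Finset.sum_congr rfl fun q _ => ?_
  have hd : ∑ j, Matrix.diagonal (fun q => (p ω q : ℂ)) q j * (ℙ[fun ω' => ((Matrix.of fun n' q' => (ℙ[fun ω'' => Hj ω'' n' q' |
                MeasurableSpace.comap Sj inferInstance]) ω')ᴴ *ᵥ vj ω') j |
            MeasurableSpace.comap Sl inferInstance]) ω = _ := Matrix.mulVec_diagonal _ _ q
  refine Eq.trans ?_ (congrArg _ hd.symm)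
  rw [hr q, Finset.mul_sum, Finset.mul_sum]
  exact Finset.sum_congr rfl fun i _ => hk n i q
end
end

section
/- Let K ≥ 1 and let Γ = diag(γ_1, …, γ_K), D = diag(d_1, …, d_K), Σ = diag(σ_1, …, σ_K) be real diagonal matrices with all γ_k > 0, d_k > 0, σ_k > 0, and let B be a K×K real matrix with nonnegative entries. Then the following are equivalent: (a) there exists an entrywise nonnegative p ∈ ℝ^K with (D − Γ B) p = Γ 𝟙; (b) there exists an entrywise nonnegative q ∈ ℝ^K with (D − Γ Bᵀ) q = Γ Σ 𝟙; (c) the spectral radius of D⁻¹ Γ B is strictly less than 1. Moreover, when these hold, the solutions p and q are unique, entrywise strictly positive, and satisfy 𝟙ᵀ q = 𝟙ᵀ Σ p. -/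
open Matrix

noncomputable section

/-- The spectral radius of a real square matrix: the supremum of the moduli of its complex
eigenvalues (the spectrum of the matrix viewed as a complex matrix). -/
def specRad {K : ℕ} (A : Matrix (Fin K) (Fin K) ℝ) : ℝ :=
  ⨆ μ : spectrum ℂ (A.map (fun t => (t : ℂ))), ‖(μ : ℂ)‖

theorem mulVec_nonneg_aux {K : ℕ} (M : Matrix (Fin K) (Fin K) ℝ) (hM : ∀ i j, 0 ≤ M i j)
    (x : Fin K → ℝ) (hx : ∀ i, 0 ≤ x i) (i : Fin K) : 0 ≤ (M *ᵥ x) i := by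
  simp only [mulVec, dotProduct]
  exact Finset.sum_nonneg (fun j _ => mul_nonneg (hM i j) (hx j))

theorem mulVec_solves_eig {K : ℕ} (M : Matrix (Fin K) (Fin K) ℝ) (hM : ∀ i j, 0 ≤ M i j)
    (x : Fin K → ℝ) (hx : ∀ i, 0 ≤ x i) (hlt : ∀ i, (M *ᵥ x) i < x i)
    (v : Fin K → ℂ) (hv : v ≠ 0) (μ : ℂ)
    (h : (M.map (fun t => (t : ℂ))) *ᵥ v = μ • v) : ‖μ‖ < 1 := by
  have hxp : ∀ i, 0 < x i := fun i => lt_of_le_of_lt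
    (mulVec_nonneg_aux M hM x hx i) (hlt i)
  obtain ⟨k, hk⟩ : ∃ k, v k ≠ 0 := by
    by_contra hcon
    push Not at hcon
    exact hv (funext hcon)
  obtain ⟨i, -, hi⟩ := Finset.exists_max_image Finset.univ (fun i => ‖v i‖ / x i) ⟨k, Finset.mem_univ k⟩
  set c := ‖v i‖ / x i with hc
  have hcpos : 0 < c := lt_of_lt_of_le (div_pos (norm_pos_iff.mpr hk) (hxp k)) (hi k (Finset.mem_univ k))
  have hvj : ∀ j, ‖v j‖ ≤ c * x j := fun j => (div_le_iff₀ (hxp j)).mp (hi j (Finset.mem_univ j))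
  have hvi : ‖v i‖ = c * x i := by rw [hc]; field_simp [(hxp i).ne']
  have h1 : ‖μ‖ * ‖v i‖ ≤ c * (M *ᵥ x) i := by
    have := congrFun h i
    simp only [Pi.smul_apply, smul_eq_mul, mulVec, dotProduct, map_apply] at this
    rw [← norm_mul, ← this]
    refine (norm_sum_le _ _).trans ?_
    simp only [mulVec, dotProduct]
    rw [Finset.mul_sum]
    refine Finset.sum_le_sum fun j _ => ?_
    rw [norm_mul, Complex.norm_real, Real.norm_of_nonneg (hM i j)]
    nlinarith [mul_le_mul_of_nonneg_left (hvj j) (hM i j)]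
  have h2 : c * (M *ᵥ x) i < c * x i := mul_lt_mul_of_pos_left (hlt i) hcpos
  rw [← hvi] at h2
  have h3 : 0 < ‖v i‖ := by rw [hvi]; exact mul_pos hcpos (hxp i)
  by_contra hcon
  push Not at hcon
  nlinarith

theorem spectrum_finite_aux {K : ℕ} (A : Matrix (Fin K) (Fin K) ℂ) : (spectrum ℂ A).Finite := by
  refine (A.charpoly.roots.toFinset.finite_toSet).subset fun μ hμ => ?_
  simp only [Finset.mem_coe, Multiset.mem_toFinset]
  exact (Polynomial.mem_roots A.charpoly_monic.ne_zero).mpr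
    (Matrix.mem_spectrum_iff_isRoot_charpoly.mp hμ)

theorem specRad_lt_one_iff {K : ℕ} (M : Matrix (Fin K) (Fin K) ℝ) :
    specRad M < 1 ↔ ∀ μ ∈ spectrum ℂ (M.map (fun t => (t : ℂ))), ‖μ‖ < 1 := by
  have hf : Finite (spectrum ℂ (M.map (fun t => (t : ℂ)))) := spectrum_finite_aux _
  unfold specRad
  constructor
  · intro h μ hμ
    exact lt_of_le_of_lt (le_ciSup (f := fun μ : spectrum ℂ (M.map (fun t => (t : ℂ))) => ‖(μ : ℂ)‖)
      (Set.finite_range _).bddAbove ⟨μ, hμ⟩) h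
  · intro h
    rcases isEmpty_or_nonempty (spectrum ℂ (M.map (fun t => (t : ℂ)))) with he | hne
    · rw [Real.iSup_of_isEmpty]; exact one_pos
    · obtain ⟨m, hm⟩ := exists_eq_ciSup_of_finite
        (f := fun μ : spectrum ℂ (M.map (fun t => (t : ℂ))) => ‖(μ : ℂ)‖)
      rw [← hm]
      exact h m m.2

theorem specRad_lt_of_sol {K : ℕ} (M : Matrix (Fin K) (Fin K) ℝ) (hM : ∀ i j, 0 ≤ M i j)
    (x : Fin K → ℝ) (hx : ∀ i, 0 ≤ x i) (hlt : ∀ i, (M *ᵥ x) i < x i) : specRad M < 1 := by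
  rw [specRad_lt_one_iff]
  intro μ hμ
  rw [← Matrix.spectrum_toLin', ← Module.End.hasEigenvalue_iff_mem_spectrum] at hμ
  obtain ⟨v, hv⟩ := hμ.exists_hasEigenvector
  refine mulVec_solves_eig M hM x hx hlt v hv.2 μ ?_
  have := hv.apply_eq_smul
  rwa [Matrix.toLin'_apply] at this

section
attribute [local instance] Matrix.linftyOpNormedRing Matrix.linftyOpNormedAlgebra

theorem pow_entry_tendsto {K : ℕ} (hK : 1 ≤ K) (A : Matrix (Fin K) (Fin K) ℂ)
    (h : ∀ μ ∈ spectrum ℂ A, ‖μ‖ < 1) (i j : Fin K) :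
    Filter.Tendsto (fun n : ℕ => (A ^ n) i j) Filter.atTop (nhds 0) := by
  have : Nonempty (Fin K) := ⟨⟨0, hK⟩⟩
  have : CompleteSpace (Matrix (Fin K) (Fin K) ℂ) := FiniteDimensional.complete ℂ _
  have h1 : spectralRadius ℂ A < ((1 : NNReal) : ENNReal) :=
    spectrum.spectralRadius_lt_of_forall_lt A (fun k hk => by exact_mod_cast h k hk)
  obtain ⟨r, hr1, hr2⟩ := ENNReal.lt_iff_exists_nnreal_btwn.mp h1
  have hr : (r : ℝ) < 1 := by exact_mod_cast hr2
  have h2 := (spectrum.pow_nnnorm_pow_one_div_tendsto_nhds_spectralRadius A).eventually_lt_const hr1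
  have h3 : Filter.Tendsto (fun n : ℕ => A ^ n) Filter.atTop (nhds 0) := by
    refine squeeze_zero_norm' ?_ (tendsto_pow_atTop_nhds_zero_of_lt_one r.2 hr)
    filter_upwards [h2, Filter.eventually_gt_atTop 0] with n hn hn0
    have hn0' : (0 : ℝ) < n := by exact_mod_cast hn0
    have h4 := ENNReal.rpow_le_rpow hn.le hn0'.le
    rw [← ENNReal.rpow_mul, one_div, inv_mul_cancel₀ hn0'.ne', ENNReal.rpow_one,
      ENNReal.rpow_natCast] at h4
    exact_mod_cast h4
  have hcont : Continuous (Matrix.entryLinearMap ℂ ℂ i j : Matrix (Fin K) (Fin K) ℂ →ₗ[ℂ] ℂ) :=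
    LinearMap.continuous_of_finiteDimensional _
  have := (hcont.tendsto 0).comp h3
  simpa [Function.comp_def] using this

end

theorem exists_sol {K : ℕ} (hK : 1 ≤ K) (M : Matrix (Fin K) (Fin K) ℝ) (hM : ∀ i j, 0 ≤ M i j)
    (h : specRad M < 1) (b : Fin K → ℝ) (hb : ∀ i, 0 ≤ b i) :
    ∃ x : Fin K → ℝ, (∀ i, 0 ≤ x i) ∧ x - M *ᵥ x = b := by
  rw [specRad_lt_one_iff] at h
  have hpow : ∀ i j, Filter.Tendsto (fun n : ℕ => (M ^ n) i j) Filter.atTop (nhds 0) := by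
    intro i j
    have h1 := pow_entry_tendsto hK _ h i j
    have h2 : ∀ n : ℕ, ((M.map (fun t => (t : ℂ))) ^ n) i j = (((M ^ n) i j : ℝ) : ℂ) := by
      intro n
      have := Matrix.map_pow M Complex.ofRealHom n
      exact (congrFun (congrFun this i) j).symm
    simp only [h2] at h1
    have h3 := (Complex.continuous_re.tendsto 0).comp h1
    simpa [Function.comp_def] using h3
  have hdet : (1 - M).det ≠ 0 := by
    intro h0
    obtain ⟨v, hv, hv0⟩ := Matrix.exists_mulVec_eq_zero_iff.mpr h0
    have hMv : M *ᵥ v = v := by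
      rw [Matrix.sub_mulVec, Matrix.one_mulVec, sub_eq_zero] at hv0
      exact hv0.symm
    have hn : ∀ n : ℕ, (M ^ n) *ᵥ v = v := by
      intro n
      induction n with
      | zero => simp
      | succ n ih => rw [pow_succ, ← Matrix.mulVec_mulVec, hMv, ih]
    apply hv
    funext i
    have h1 : Filter.Tendsto (fun n : ℕ => ((M ^ n) *ᵥ v) i) Filter.atTop
        (nhds (∑ j, 0 * v j)) :=
      tendsto_finsetSum _ fun j _ => (hpow i j).mul_const _
    simp only [hn, zero_mul, Finset.sum_const_zero] at h1
    exact tendsto_nhds_unique tendsto_const_nhds h1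
  set x := (1 - M)⁻¹ *ᵥ b with hx
  have hsol : x - M *ᵥ x = b := by
    have : (1 - M) *ᵥ x = b := by
      rw [hx, Matrix.mulVec_mulVec, Matrix.mul_nonsing_inv _ (isUnit_iff_ne_zero.mpr hdet),
        Matrix.one_mulVec]
    rwa [Matrix.sub_mulVec, Matrix.one_mulVec] at this
  refine ⟨x, ?_, hsol⟩
  have hnn : ∀ n : ℕ, ∀ i j, 0 ≤ (M ^ n) i j := by
    intro n
    induction n with
    | zero => intro i j; rw [pow_zero, Matrix.one_apply]; split_ifs <;> norm_num
    | succ n ih =>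
      intro i j
      rw [pow_succ, Matrix.mul_apply]
      exact Finset.sum_nonneg fun k _ => mul_nonneg (ih i k) (hM k j)
  have hle : ∀ n : ℕ, ∀ i, ((M ^ n) *ᵥ x) i ≤ x i := by
    intro n
    induction n with
    | zero => intro i; simp
    | succ n ih =>
      intro i
      refine le_trans ?_ (ih i)
      rw [pow_succ, ← Matrix.mulVec_mulVec]
      change ∑ k, (M ^ n) i k * (M *ᵥ x) k ≤ ∑ k, (M ^ n) i k * x k
      refine Finset.sum_le_sum fun k _ => mul_le_mul_of_nonneg_left ?_ (hnn n i k)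
      have := congrFun hsol k
      have hbk := hb k
      simp only [Pi.sub_apply] at this
      linarith
  intro i
  have h1 : Filter.Tendsto (fun n : ℕ => ((M ^ n) *ᵥ x) i) Filter.atTop
      (nhds (∑ j, 0 * x j)) :=
    tendsto_finsetSum _ fun j _ => (hpow i j).mul_const _
  simp only [zero_mul, Finset.sum_const_zero] at h1
  exact le_of_tendsto' h1 fun n => hle n i

theorem sol_unique {K : ℕ} (M : Matrix (Fin K) (Fin K) ℝ) (hM : ∀ i j, 0 ≤ M i j)
    (b : Fin K → ℝ) (hb : ∀ i, 0 < b i)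
    (x : Fin K → ℝ) (hx : ∀ i, 0 ≤ x i) (hxb : x - M *ᵥ x = b)
    (y : Fin K → ℝ) (hyb : y - M *ᵥ y = b) : y = x := by
  by_contra hne
  have hlt : ∀ i, (M *ᵥ x) i < x i := by
    intro i
    have := congrFun hxb i
    have hbi := hb i
    simp only [Pi.sub_apply] at this
    linarith
  have hfix : M *ᵥ (y - x) = y - x := by
    rw [Matrix.mulVec_sub]
    funext i
    have h1 := congrFun hxb i
    have h2 := congrFun hyb i
    simp only [Pi.sub_apply] at h1 h2 ⊢
    linarith
  have := mulVec_solves_eig M hM x hx hlt (fun i => (((y - x) i : ℝ) : ℂ)) ?_ 1 ?_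
  · simp at this
  · intro h0
    apply hne
    funext i
    have := congrFun h0 i
    have h3 : (y - x) i = 0 := Complex.ofReal_eq_zero.mp this
    simp only [Pi.sub_apply] at h3
    linarith
  · funext i
    have := congrFun hfix i
    simp only [mulVec, dotProduct] at this
    simp only [mulVec, dotProduct, Matrix.map_apply, one_smul]
    rw [← this]
    push_cast
    rfl

theorem specRad_congr {K : ℕ} (a : Fin K → ℝ) (B : Matrix (Fin K) (Fin K) ℝ) :
    specRad (Matrix.diagonal a * Bᵀ) = specRad (Matrix.diagonal a * B) := by
  have hc : (Matrix.diagonal a * Bᵀ).charpoly = (Matrix.diagonal a * B).charpoly := by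
    rw [← Matrix.charpoly_transpose, Matrix.transpose_mul, Matrix.transpose_transpose,
      Matrix.diagonal_transpose, Matrix.charpoly_mul_comm]
  have hs : spectrum ℂ ((Matrix.diagonal a * Bᵀ).map (fun t => (t : ℂ))) =
      spectrum ℂ ((Matrix.diagonal a * B).map (fun t => (t : ℂ))) := by
    ext μ
    rw [Matrix.mem_spectrum_iff_isRoot_charpoly, Matrix.mem_spectrum_iff_isRoot_charpoly]
    have h1 := Matrix.charpoly_map (Matrix.diagonal a * Bᵀ) Complex.ofRealHom
    have h2 := Matrix.charpoly_map (Matrix.diagonal a * B) Complex.ofRealHom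
    rw [hc, ← h2] at h1
    exact iff_of_eq (congrArg (fun p => Polynomial.IsRoot p μ) h1)
  unfold specRad
  rw [hs]

theorem system_iff {K : ℕ} (γ d c : Fin K → ℝ) (hd : ∀ i, 0 < d i)
    (B : Matrix (Fin K) (Fin K) ℝ) (p : Fin K → ℝ) :
    (Matrix.diagonal d - Matrix.diagonal γ * B) *ᵥ p = c ↔
      p - (Matrix.diagonal (fun i => γ i / d i) * B) *ᵥ p = fun i => c i / d i := by
  rw [funext_iff, funext_iff]
  refine forall_congr' fun i => ?_
  rw [Matrix.sub_mulVec, ← Matrix.mulVec_mulVec, ← Matrix.mulVec_mulVec]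
  simp only [Pi.sub_apply, Matrix.mulVec_diagonal]
  have := (hd i).ne'
  rw [eq_div_iff this]
  field_simp

theorem both_iff {K : ℕ} (hK : 1 ≤ K) (γ d c : Fin K → ℝ)
    (hγ : ∀ i, 0 < γ i) (hd : ∀ i, 0 < d i) (hc : ∀ i, 0 < c i)
    (B : Matrix (Fin K) (Fin K) ℝ) (hB : ∀ i j, 0 ≤ B i j) :
    ((∃ p : Fin K → ℝ, (∀ i, 0 ≤ p i) ∧
        (Matrix.diagonal d - Matrix.diagonal γ * B) *ᵥ p = c) ↔
      specRad (Matrix.diagonal (fun i => γ i / d i) * B) < 1) ∧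
    ∀ p : Fin K → ℝ, (∀ i, 0 ≤ p i) →
        (Matrix.diagonal d - Matrix.diagonal γ * B) *ᵥ p = c →
        (∀ i, 0 < p i) ∧ ∀ p' : Fin K → ℝ,
          (Matrix.diagonal d - Matrix.diagonal γ * B) *ᵥ p' = c → p' = p := by
  have hM : ∀ i j, 0 ≤ (Matrix.diagonal (fun i => γ i / d i) * B) i j := by
    intro i j
    rw [Matrix.diagonal_mul]
    exact mul_nonneg (div_pos (hγ i) (hd i)).le (hB i j)
  have hb : ∀ i, 0 < c i / d i := fun i => div_pos (hc i) (hd i)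
  simp only [system_iff γ d c hd B]
  have hlt : ∀ p : Fin K → ℝ,
      p - (Matrix.diagonal (fun i => γ i / d i) * B) *ᵥ p = (fun i => c i / d i) →
      ∀ i, ((Matrix.diagonal (fun i => γ i / d i) * B) *ᵥ p) i < p i := by
    intro p h i
    have := congrFun h i
    have hbi := hb i
    simp only [Pi.sub_apply] at this
    linarith
  refine ⟨⟨?_, fun h => exists_sol hK _ hM h _ fun i => (hb i).le⟩, ?_⟩
  · rintro ⟨p, hp, h⟩
    exact specRad_lt_of_sol _ hM p hp (hlt p h)
  · intro p hp h
    exact ⟨fun i => lt_of_le_of_lt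
      (mulVec_nonneg_aux _ hM p hp i) (hlt p h i),
      fun p' h' => sol_unique _ hM _ hb p hp h p' h'⟩

/-- Uplink–downlink duality, matrix-theoretic core. With
`Γ = diag γ`, `D = diag d`, `Σ = diag σ` positive diagonal and `B` entrywise nonnegative:
(a) existence of a nonnegative solution of `(D − Γ B) p = Γ 𝟙`,
(b) existence of a nonnegative solution of `(D − Γ Bᵀ) q = Γ Σ 𝟙`, and
(c) `specRad (D⁻¹ Γ B) < 1`
are equivalent; and when they hold, the solutions are unique, entrywise strictly positive,
and satisfy `𝟙ᵀ q = 𝟙ᵀ Σ p`. -/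
theorem uplink_downlink_duality_core
    {K : ℕ} (hK : 1 ≤ K) (γ d σv : Fin K → ℝ)
    (hγ : ∀ i, 0 < γ i) (hd : ∀ i, 0 < d i) (hσ : ∀ i, 0 < σv i)
    (B : Matrix (Fin K) (Fin K) ℝ) (hB : ∀ i j, 0 ≤ B i j) :
    ((∃ p : Fin K → ℝ, (∀ i, 0 ≤ p i) ∧
        (Matrix.diagonal d - Matrix.diagonal γ * B) *ᵥ p =
          Matrix.diagonal γ *ᵥ (fun _ => 1)) ↔
      specRad ((Matrix.diagonal d)⁻¹ * Matrix.diagonal γ * B) < 1) ∧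
    ((∃ q : Fin K → ℝ, (∀ i, 0 ≤ q i) ∧
        (Matrix.diagonal d - Matrix.diagonal γ * Bᵀ) *ᵥ q =
          (Matrix.diagonal γ * Matrix.diagonal σv) *ᵥ (fun _ => 1)) ↔
      specRad ((Matrix.diagonal d)⁻¹ * Matrix.diagonal γ * B) < 1) ∧
    ∀ p q : Fin K → ℝ,
      (∀ i, 0 ≤ p i) →
      (Matrix.diagonal d - Matrix.diagonal γ * B) *ᵥ p =
        Matrix.diagonal γ *ᵥ (fun _ => 1) →
      (∀ i, 0 ≤ q i) →
      (Matrix.diagonal d - Matrix.diagonal γ * Bᵀ) *ᵥ q =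
        (Matrix.diagonal γ * Matrix.diagonal σv) *ᵥ (fun _ => 1) →
      (∀ i, 0 < p i) ∧ (∀ i, 0 < q i) ∧
      (∀ p' : Fin K → ℝ, (∀ i, 0 ≤ p' i) →
        (Matrix.diagonal d - Matrix.diagonal γ * B) *ᵥ p' =
          Matrix.diagonal γ *ᵥ (fun _ => 1) → p' = p) ∧
      (∀ q' : Fin K → ℝ, (∀ i, 0 ≤ q' i) →
        (Matrix.diagonal d - Matrix.diagonal γ * Bᵀ) *ᵥ q' =
          (Matrix.diagonal γ * Matrix.diagonal σv) *ᵥ (fun _ => 1) → q' = q) ∧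
      ∑ i, q i = ∑ i, σv i * p i := by
  have hD : (Matrix.diagonal d)⁻¹ * Matrix.diagonal γ = Matrix.diagonal (fun i => γ i / d i) := by
    have : (Matrix.diagonal d)⁻¹ = Matrix.diagonal (fun i => (d i)⁻¹) := by
      apply Matrix.inv_eq_right_inv
      rw [Matrix.diagonal_mul_diagonal, ← Matrix.diagonal_one]
      congr 1
      funext i
      exact mul_inv_cancel₀ (hd i).ne'
    rw [this, Matrix.diagonal_mul_diagonal]
    congr 1
    funext i
    rw [div_eq_inv_mul]
  have hc1 : Matrix.diagonal γ *ᵥ (fun _ => (1 : ℝ)) = γ := by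
    funext i; simp [Matrix.mulVec_diagonal]
  have hc2 : (Matrix.diagonal γ * Matrix.diagonal σv) *ᵥ (fun _ => (1 : ℝ)) =
      fun i => γ i * σv i := by
    funext i; simp [Matrix.mulVec_diagonal]
  rw [hD, hc1, hc2]
  obtain ⟨hp1, hp2⟩ := both_iff hK γ d γ hγ hd hγ B hB
  obtain ⟨hq1, hq2⟩ := both_iff hK γ d (fun i => γ i * σv i) hγ hd
    (fun i => mul_pos (hγ i) (hσ i)) Bᵀ (fun i j => hB j i)
  rw [specRad_congr] at hq1
  refine ⟨hp1, hq1, ?_⟩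
  intro p q hp hpe hq hqe
  refine ⟨(hp2 p hp hpe).1, (hq2 q hq hqe).1, fun p' _ h => (hp2 p hp hpe).2 p' h,
    fun q' _ h => (hq2 q hq hqe).2 q' h, ?_⟩
  have e1 : ∀ i, d i / γ i * p i - (B *ᵥ p) i = 1 := by
    intro i
    have := congrFun hpe i
    rw [Matrix.sub_mulVec, ← Matrix.mulVec_mulVec] at this
    simp only [Pi.sub_apply, Matrix.mulVec_diagonal] at this
    have hg := (hγ i).ne'
    field_simp
    linarith
  have e2 : ∀ i, d i / γ i * q i - (Bᵀ *ᵥ q) i = σv i := by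
    intro i
    have := congrFun hqe i
    rw [Matrix.sub_mulVec, ← Matrix.mulVec_mulVec] at this
    simp only [Pi.sub_apply, Matrix.mulVec_diagonal] at this
    have hg := (hγ i).ne'
    field_simp
    linarith
  have e3 : ∑ i, q i * (B *ᵥ p) i = ∑ i, (Bᵀ *ᵥ q) i * p i := by
    have h := Matrix.dotProduct_mulVec q B p
    rw [← Matrix.mulVec_transpose] at h
    exact h
  have e4 : ∑ i, q i = ∑ i, d i / γ i * p i * q i - ∑ i, q i * (B *ᵥ p) i := by
    rw [← Finset.sum_sub_distrib]
    refine Finset.sum_congr rfl fun i _ => ?_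
    linear_combination (-q i) * e1 i
  have e5 : ∑ i, σv i * p i = ∑ i, d i / γ i * p i * q i - ∑ i, (Bᵀ *ᵥ q) i * p i := by
    rw [← Finset.sum_sub_distrib]
    refine Finset.sum_congr rfl fun i _ => ?_
    linear_combination (-p i) * e2 i
  rw [e4, e5, e3]
end
end

section
/- Let A be a K×K real matrix with nonnegative entries and b ∈ ℝ^K a vector with strictly positive entries. Then there exists an entrywise nonnegative p ∈ ℝ^K with p = A p + b if and only if the spectral radius of A is strictly less than 1; moreover, in that case the fixed point p is unique (and entrywise strictly positive). -/
open Matrix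

noncomputable section

lemma aux_pos {K : ℕ} {A : Matrix (Fin K) (Fin K) ℝ} (hA : ∀ i j, 0 ≤ A i j)
    {b : Fin K → ℝ} (hb : ∀ i, 0 < b i) (p : Fin K → ℝ) (hp : ∀ i, 0 ≤ p i)
    (h : p = A *ᵥ p + b) (i : Fin K) : 0 < p i := by
  rw [h]
  have : 0 ≤ (A *ᵥ p) i := by
    simp only [Matrix.mulVec, dotProduct]
    exact Finset.sum_nonneg fun j _ => mul_nonneg (hA i j) (hp j)
  have := hb i
  simp only [Pi.add_apply]
  linarith

lemma aux_eig {K : ℕ} {A : Matrix (Fin K) (Fin K) ℝ} (hA : ∀ i j, 0 ≤ A i j)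
    {b : Fin K → ℝ} (hb : ∀ i, 0 < b i) (p : Fin K → ℝ) (hp : ∀ i, 0 < p i)
    (h : p = A *ᵥ p + b) (μ : ℂ) (v : Fin K → ℂ) (hv : v ≠ 0)
    (hμ : (A.map (fun t => (t : ℂ))) *ᵥ v = μ • v) : ‖μ‖ < 1 := by
  obtain ⟨k, hk⟩ : ∃ k, v k ≠ 0 := by
    by_contra! hc
    exact hv (funext hc)
  have : Nonempty (Fin K) := ⟨k⟩
  obtain ⟨i, hi⟩ := Finite.exists_max (fun i => ‖v i‖ / p i)
  set c := ‖v i‖ / p i with hc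
  have hc0 : 0 < c := lt_of_lt_of_le (div_pos (norm_pos_iff.2 hk) (hp k)) (hi k)
  have hvi : ‖v i‖ = c * p i := by rw [hc]; field_simp [(hp i).ne']
  have hle : ∀ j, ‖v j‖ ≤ c * p j := fun j => (div_le_iff₀ (hp j)).1 (hi j)
  have h1 : ‖μ‖ * ‖v i‖ ≤ ∑ j, A i j * (c * p j) := by
    have : μ * v i = ∑ j, (A i j : ℂ) * v j := by
      have := congrFun hμ i
      simpa [Matrix.mulVec, dotProduct] using this.symm
    rw [← norm_mul, this]
    refine (norm_sum_le _ _).trans (Finset.sum_le_sum fun j _ => ?_)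
    rw [norm_mul, Complex.norm_real, Real.norm_of_nonneg (hA i j)]
    exact mul_le_mul_of_nonneg_left (hle j) (hA i j)
  have h2 : ∑ j, A i j * (c * p j) = c * (A *ᵥ p) i := by
    simp only [Matrix.mulVec, dotProduct, Finset.mul_sum]
    exact Finset.sum_congr rfl fun j _ => by ring
  have h3 : p i = (A *ᵥ p) i + b i := congrFun h i
  have h4 : ‖μ‖ * (c * p i) < 1 * (c * p i) := by
    rw [← hvi]
    refine h1.trans_lt ?_
    rw [h2, one_mul, hvi]
    exact mul_lt_mul_of_pos_left (by linarith [hb i]) hc0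
  exact lt_of_mul_lt_mul_right h4 (mul_pos hc0 (hp i)).le

lemma aux_finite {K : ℕ} (B : Matrix (Fin K) (Fin K) ℂ) : (spectrum ℂ B).Finite := 
  Matrix.finite_spectrum B

lemma aux_forward {K : ℕ} {A : Matrix (Fin K) (Fin K) ℝ} (hA : ∀ i j, 0 ≤ A i j)
    {b : Fin K → ℝ} (hb : ∀ i, 0 < b i) (p : Fin K → ℝ) (hp : ∀ i, 0 ≤ p i)
    (h : p = A *ᵥ p + b) : specRad A < 1 := by
  unfold specRad
  set B := A.map (fun t => (t : ℂ)) with hB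
  have : Finite (spectrum ℂ B) := (aux_finite B).to_subtype
  rcases isEmpty_or_nonempty (spectrum ℂ B) with he | hne
  · rw [Real.iSup_of_isEmpty]; norm_num
  · obtain ⟨⟨μ, hμ⟩, he⟩ := exists_eq_ciSup_of_finite (f := fun μ : spectrum ℂ B => ‖(μ : ℂ)‖)
    rw [← he]
    rw [← Matrix.spectrum_toLin', ← Module.End.hasEigenvalue_iff_mem_spectrum] at hμ
    obtain ⟨v, hv⟩ := hμ.exists_hasEigenvector
    refine aux_eig hA hb p (aux_pos hA hb p hp h) h μ v hv.2 ?_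
    simpa using hv.apply_eq_smul

section
attribute [local instance] Matrix.linftyOpNormedRing Matrix.linftyOpNormedAlgebra

lemma aux_pow {K : ℕ} (A : Matrix (Fin K) (Fin K) ℝ) (h : specRad A < 1) (i j : Fin K) :
    Filter.Tendsto (fun n : ℕ => (A ^ n) i j) Filter.atTop (nhds 0) := by
  set B := A.map (fun t => (t : ℂ)) with hB
  have : Finite (spectrum ℂ B) := (aux_finite B).to_subtype
  have h1 : spectralRadius ℂ B < 1 := by
    refine lt_of_le_of_lt (b := ENNReal.ofReal (specRad A)) ?_ (by simpa using h)
    refine iSup₂_le fun k hk => ?_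
    have : ‖k‖ ≤ specRad A :=
      le_ciSup (f := fun μ : spectrum ℂ B => ‖(μ : ℂ)‖) (Set.finite_range _).bddAbove ⟨k, hk⟩
    change ‖k‖ₑ ≤ _
    rw [← ofReal_norm]
    exact ENNReal.ofReal_le_ofReal this
  have : CompleteSpace (Matrix (Fin K) (Fin K) ℂ) := FiniteDimensional.complete ℂ _
  obtain ⟨r, hr, hr1⟩ := ENNReal.lt_iff_exists_nnreal_btwn.1 h1
  have h2 := (spectrum.pow_nnnorm_pow_one_div_tendsto_nhds_spectralRadius B).eventually_lt_const hr
  have h3 : ∀ᶠ n : ℕ in Filter.atTop, ‖(A ^ n) i j‖ ≤ (r : ℝ) ^ n := by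
    filter_upwards [h2, Filter.eventually_gt_atTop 0] with n hn hn0
    have h4 : (‖B ^ n‖₊ : ENNReal) ≤ (r : ENNReal) ^ n := by
      have := ENNReal.rpow_le_rpow hn.le (Nat.cast_nonneg n : (0:ℝ) ≤ n)
      rwa [← ENNReal.rpow_mul, one_div_mul_cancel (by positivity), ENNReal.rpow_one,
        ENNReal.rpow_natCast] at this
    have h5 : ‖B ^ n‖₊ ≤ r ^ n := by exact_mod_cast h4
    have h6 : (B ^ n) i j = ((A ^ n) i j : ℂ) := by
      have : B ^ n = (A ^ n).map Complex.ofRealHom := by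
        rw [Matrix.map_pow]; rfl
      rw [this]; rfl
    have h7 : ‖(B ^ n) i j‖₊ ≤ ‖B ^ n‖₊ := by
      rw [Matrix.linfty_opNNNorm_def]
      refine le_trans ?_ (Finset.le_sup (Finset.mem_univ i))
      exact Finset.single_le_sum (f := fun j => ‖(B ^ n) i j‖₊) (fun _ _ => zero_le) (Finset.mem_univ j)
    have h8 := h7.trans h5
    rw [h6, Complex.nnnorm_real] at h8
    exact_mod_cast h8
  exact squeeze_zero_norm' h3 (tendsto_pow_atTop_nhds_zero_of_lt_one r.2 (by exact_mod_cast hr1))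
end

lemma aux_mulVec {K : ℕ} (A : Matrix (Fin K) (Fin K) ℝ) (h : specRad A < 1) (d : Fin K → ℝ)
    (i : Fin K) : Filter.Tendsto (fun n : ℕ => ((A ^ n) *ᵥ d) i) Filter.atTop (nhds 0) := by
  have := tendsto_finsetSum Finset.univ
    (fun j _ => (aux_pow A h i j).mul_const (d j))
  simpa [Matrix.mulVec, dotProduct] using this

lemma aux_inj {K : ℕ} (A : Matrix (Fin K) (Fin K) ℝ) (h : specRad A < 1) (d : Fin K → ℝ)
    (hd : d = A *ᵥ d) : d = 0 := by
  have hn : ∀ n : ℕ, (A ^ n) *ᵥ d = d := by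
    intro n
    induction n with
    | zero => simp
    | succ n ih => rw [pow_succ, ← Matrix.mulVec_mulVec, ← hd, ih]
  funext i
  have := aux_mulVec A h d i
  simp only [hn] at this
  exact tendsto_nhds_unique tendsto_const_nhds this

lemma aux_nonneg {K : ℕ} {A : Matrix (Fin K) (Fin K) ℝ} (hA : ∀ i j, 0 ≤ A i j)
    {b : Fin K → ℝ} (hb : ∀ i, 0 < b i) (h : specRad A < 1) (p : Fin K → ℝ)
    (hp : p = A *ᵥ p + b) (i : Fin K) : 0 ≤ p i := by
  have hn : ∀ n : ℕ, ∀ i, ((A ^ n) *ᵥ p) i ≤ p i := by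
    intro n
    induction n with
    | zero => simp
    | succ n ih =>
      intro i
      rw [pow_succ', ← Matrix.mulVec_mulVec]
      have h1 : (A *ᵥ ((A ^ n) *ᵥ p)) i ≤ (A *ᵥ p) i := by
        rw [Matrix.mulVec, Matrix.mulVec, dotProduct, dotProduct]
        exact Finset.sum_le_sum fun j _ => mul_le_mul_of_nonneg_left (ih j) (hA i j)
      have h2 : p i = (A *ᵥ p) i + b i := congrFun hp i
      linarith [hb i]
  exact le_of_tendsto' (aux_mulVec A h p i) fun n => hn n i

lemma aux_exists {K : ℕ} (A : Matrix (Fin K) (Fin K) ℝ) (h : specRad A < 1) (b : Fin K → ℝ) :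
    ∃ p, p = A *ᵥ p + b := by
  have hinj : Function.Injective (Matrix.toLin' (1 - A)) := by
    rw [injective_iff_map_eq_zero]
    intro d hd
    rw [Matrix.toLin'_apply, Matrix.sub_mulVec, Matrix.one_mulVec, sub_eq_zero] at hd
    exact aux_inj A h d hd
  obtain ⟨p, hp⟩ := LinearMap.injective_iff_surjective.1 hinj b
  refine ⟨p, ?_⟩
  rw [Matrix.toLin'_apply, Matrix.sub_mulVec, Matrix.one_mulVec] at hp
  rw [← hp]; abel

theorem affine_interference_fixed_point
    {K : ℕ} (A : Matrix (Fin K) (Fin K) ℝ) (hA : ∀ i j, 0 ≤ A i j)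
    (b : Fin K → ℝ) (hb : ∀ i, 0 < b i) :
    ((∃ p : Fin K → ℝ, (∀ i, 0 ≤ p i) ∧ p = A *ᵥ p + b) ↔ specRad A < 1) ∧
      (specRad A < 1 → ∃! p : Fin K → ℝ, (∀ i, 0 ≤ p i) ∧ p = A *ᵥ p + b) ∧
      ∀ p : Fin K → ℝ, (∀ i, 0 ≤ p i) → p = A *ᵥ p + b → ∀ i, 0 < p i := by
  have hex : specRad A < 1 → ∃! p : Fin K → ℝ, (∀ i, 0 ≤ p i) ∧ p = A *ᵥ p + b := by
    intro h
    obtain ⟨p, hp⟩ := aux_exists A h b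
    refine ⟨p, ⟨aux_nonneg hA hb h p hp, hp⟩, ?_⟩
    rintro q ⟨-, hq⟩
    rw [← sub_eq_zero]
    refine aux_inj A h _ ?_
    rw [Matrix.mulVec_sub]
    nth_rw 1 [hq, hp]
    abel
  refine ⟨⟨fun ⟨p, hp, h⟩ => aux_forward hA hb p hp h, fun h => (hex h).exists⟩, hex, ?_⟩
  exact fun p hp h => aux_pos hA hb p hp h
end
end
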